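/- arXiv:1602.06796 — 2 statements merged into one kernel-verified Lean document; each statement's English description precedes it below -/
import Mathlib

section
/- (Stanley) For every m ≥ 0, the number of self-complementary plane partitions in the 2m-cube, i.e. of lower sets S of Fin (2m) × Fin (2m) × Fin (2m) under the componentwise order satisfying (i,j,k) ∈ S ↔ (2m-1-i, 2m-1-j, 2m-1-k) ∉ S, equals the square of the number of plane partitions in the m-cube; explicitly it equals ∏_{i=0}^{m-1} (i!)²·((i+2m)!)² / ((i+m)!)⁴. -/
namespace SCPP

open Finset Matrix



theorem det_pi_sum {n : ℕ} {α R : Type*} [DecidableEq α] [CommRing R] (s : Fin n → Finset α)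
    (g : Fin n → α → Fin n → R) :
    Matrix.det (Matrix.of fun i j => ∑ y ∈ s i, g i y j) =
      ∑ y ∈ Fintype.piFinset s, Matrix.det (Matrix.of fun i j => g i (y i) j) := by
  have h : ∀ M : Matrix (Fin n) (Fin n) R, M.det = Mᵀ.det := fun M => (Matrix.det_transpose M).symm
  rw [h]
  simp only [h (Matrix.of fun i j => g i (_ : α) j)]
  simp only [Matrix.det_apply, Matrix.transpose_apply, Matrix.of_apply, Finset.prod_univ_sum]
  rw [Finset.sum_comm]
  refine Finset.sum_congr rfl fun σ _ => ?_
  rw [Finset.smul_sum]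

open scoped Classical in
theorem andreief {m N : ℕ} {R : Type*} [CommRing R] (A B : Fin m → Fin N → R) :
    ∑ z : {z : Fin m → Fin N // StrictMono z},
      Matrix.det (Matrix.of fun i k => A i (z.1 k)) * Matrix.det (Matrix.of fun i k => B i (z.1 k)) =
    Matrix.det (Matrix.of fun i j => ∑ x, A i x * B j x) := by
  have h1 := det_pi_sum (fun _ : Fin m => (Finset.univ : Finset (Fin N)))
    (fun i x j => A i x * B j x)
  rw [h1, Fintype.piFinset_univ]
  have h2 : ∀ y : Fin m → Fin N, Matrix.det (Matrix.of fun i j => A i (y i) * B j (y i)) =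
      (∏ i, A i (y i)) * Matrix.det (Matrix.of fun i k => B i (y k)) := by
    intro y
    rw [← Matrix.det_transpose (Matrix.of fun i k => B i (y k)), ← Matrix.det_mul_column]
    rfl
  simp only [h2]
  have h3 : ∀ y : Fin m → Fin N, ¬ Function.Injective y →
      Matrix.det (Matrix.of fun i k => B i (y k)) = 0 := by
    intro y hy
    simp only [Function.Injective, not_forall] at hy
    obtain ⟨a, b, hab, hne⟩ := hy
    exact Matrix.det_zero_of_column_eq hne (fun i => by simp [hab])
  have h4 : ∑ y : Fin m → Fin N, (∏ i, A i (y i)) * Matrix.det (Matrix.of fun i k => B i (y k)) =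
      ∑ p : {z : Fin m → Fin N // StrictMono z} × Equiv.Perm (Fin m),
        (∏ i, A i (p.1.1 (p.2 i))) * Matrix.det (Matrix.of fun i k => B i (p.1.1 (p.2 k))) := by
    symm
    rw [← Finset.sum_subset (Finset.subset_univ
      ((Finset.univ : Finset (Fin m → Fin N)).filter Function.Injective))
      (fun y _ hy => by rw [h3 y (by simpa using hy), mul_zero])]
    refine Finset.sum_bij (fun p _ => p.1.1 ∘ p.2) ?_ ?_ ?_ ?_
    · intro p _
      simpa using p.1.2.injective.comp p.2.injective
    · rintro ⟨⟨z, hz⟩, σ⟩ _ ⟨⟨z', hz'⟩, σ'⟩ _ h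
      have hr : Set.range z = Set.range z' := by
        have := congrArg Set.range h
        simpa [Set.range_comp] using this
      have hzz : z = z' := (hz.range_inj hz').1 hr
      subst hzz
      have : σ = σ' := by
        ext i
        have := congrFun h i
        exact congrArg Fin.val (hz.injective this)
      subst this
      rfl
    · intro y hy
      have hy : Function.Injective y := by simpa using hy
      refine ⟨(⟨y ∘ Tuple.sort y, (Tuple.monotone_sort y).strictMono_of_injective
        (hy.comp (Tuple.sort y).injective)⟩, (Tuple.sort y)⁻¹), Finset.mem_univ _, ?_⟩
      ext i
      simp
    · intro p _
      rfl
  rw [h4, Fintype.sum_prod_type]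
  refine Finset.sum_congr rfl fun z _ => ?_
  have h5 : ∀ σ : Equiv.Perm (Fin m), Matrix.det (Matrix.of fun i k => B i (z.1 (σ k))) =
      (Equiv.Perm.sign σ : ℤ) * Matrix.det (Matrix.of fun i k => B i (z.1 k)) := by
    intro σ
    rw [← Matrix.det_permute']
    rfl
  simp only [h5]
  rw [← Matrix.det_transpose (Matrix.of fun i k => A i (z.1 k)), Matrix.det_apply', Finset.sum_mul]
  refine Finset.sum_congr rfl fun σ _ => ?_
  simp only [Matrix.transpose_apply, Matrix.of_apply]
  ring

theorem det_monic {m : ℕ} (a : ℕ → ℚ) (v : Fin m → ℚ) :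
    Matrix.det (Matrix.of fun (i k : Fin m) => ∏ l ∈ range i, (v k - a l)) =
      Matrix.det (Matrix.vandermonde v) := by
  have := Matrix.det_eval_matrixOfPolynomials_eq_det_vandermonde v
    (fun i => ∏ l ∈ range (i : ℕ), (Polynomial.X - Polynomial.C (a l)))
    (fun i => by
      rw [Polynomial.natDegree_prod_of_monic _ _ (fun _ _ => Polynomial.monic_X_sub_C _)]
      simp)
    (fun i => Polynomial.monic_prod_of_monic _ _ (fun _ _ => Polynomial.monic_X_sub_C _))
  rw [this, ← Matrix.det_transpose]
  congr 1
  ext i k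
  simp [Polynomial.eval_prod]

open scoped Classical in
theorem V_sum {m N : ℕ} (w t : ℕ → ℚ) (a b : ℕ → ℚ) :
    ∑ z : {z : Fin m → Fin N // StrictMono z},
      (∏ k, w (z.1 k)) * Matrix.det (Matrix.vandermonde (fun k => t (z.1 k))) ^ 2 =
    Matrix.det (Matrix.of fun i j : Fin m => ∑ x ∈ range N,
      w x * (∏ l ∈ range i, (t x - a l)) * ∏ l ∈ range j, (t x - b l)) := by
  have := andreief (m := m) (N := N) (fun i x => w x * (∏ l ∈ range i, (t x - a l)))
    (fun i x => (∏ l ∈ range i, (t x - b l)))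
  simp only [Finset.sum_range]
  rw [← this]
  refine Finset.sum_congr rfl fun z _ => ?_
  rw [det_monic b (fun k => t (z.1 k)), ← det_monic a (fun k => t (z.1 k))]
  have h := Matrix.det_mul_row (fun k => w (z.1 k)) (Matrix.of fun (i k : Fin m) => ∏ l ∈ range i, (t (z.1 k) - a l))
  simp only [Matrix.of_apply] at h
  rw [h, det_monic a (fun k => t (z.1 k))]
  ring

theorem sum_choose_antidiag (n i j : ℕ) :
    ∑ p ∈ antidiagonal n, (p.1.choose i) * (p.2.choose j) = (n + 1).choose (i + j + 1) := by
  induction j generalizing n with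
  | zero =>
    simp only [Nat.choose_zero_right, mul_one, add_zero]
    rw [Finset.Nat.sum_antidiagonal_eq_sum_range_succ (fun a _ => a.choose i)]
    induction n with
    | zero => cases i <;> simp [Nat.choose_succ_succ]
    | succ n ih => rw [Finset.sum_range_succ, ih, Nat.choose_succ_succ (n + 1), add_comm]
  | succ j ih =>
    induction n with
    | zero =>
      rw [Nat.choose_eq_zero_of_lt (by omega)]
      simp
    | succ n ihn =>
      rw [Finset.Nat.sum_antidiagonal_succ']
      simp only [Nat.choose_succ_succ, mul_add, Finset.sum_add_distrib, ih, ihn]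
      simp only [Nat.choose_zero_succ, mul_zero, zero_add]
      rw [show i + (j + 1) = (i + j) + 1 by ring, Nat.choose_succ_succ n (i + j)]

theorem sum_range_choose1 (N i j : ℕ) :
    ∑ x ∈ range N, (x.choose i) * ((N - 1 - x).choose j) = N.choose (i + j + 1) := by
  cases N with
  | zero => simp
  | succ n =>
    rw [← sum_choose_antidiag,
      Finset.Nat.sum_antidiagonal_eq_sum_range_succ (fun a b => a.choose i * b.choose j)]
    simp

theorem sum_range_choose2 (N i j : ℕ) :
    ∑ x ∈ range N, ((x + i).choose i) * ((N - 1 - x).choose j) = (N + i).choose (i + j + 1) := by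
  rw [← sum_range_choose1, add_comm N i, Finset.sum_range_add,
    Finset.sum_eq_zero (s := range i), zero_add]
  · refine Finset.sum_congr rfl fun x hx => ?_
    rw [add_comm x i]
    congr 2
    omega
  · intro x hx
    rw [Nat.choose_eq_zero_of_lt (by simpa using hx), zero_mul]




theorem abs_det_scale {m : ℕ} (r c : Fin m → ℚ) (M : Fin m → Fin m → ℚ) :
    |Matrix.det (Matrix.of fun i j => r i * c j * M i j)| =
      |∏ i, r i| * |∏ j, c j| * |Matrix.det (Matrix.of M)| := by
  have h1 := Matrix.det_mul_column r (Matrix.of fun i j => c j * M i j)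
  have h2 := Matrix.det_mul_row c (Matrix.of M)
  simp only [Matrix.of_apply] at h1 h2
  simp only [mul_assoc]
  rw [h1, h2, abs_mul, abs_mul]

theorem abs_prod_neg_one {m : ℕ} (c : ℕ → ℚ) (hc : ∀ i, 0 ≤ c i) :
    |∏ j : Fin m, ((-1) ^ (j : ℕ) * c j)| = ∏ j ∈ range m, c j := by
  rw [Finset.abs_prod, Finset.prod_range]
  refine Finset.prod_congr rfl fun j _ => ?_
  rw [abs_mul, abs_pow]
  simp [abs_of_nonneg (hc j)]

theorem abs_prod_pos {m : ℕ} (c : ℕ → ℚ) (hc : ∀ i, 0 ≤ c i) :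
    |∏ j : Fin m, (c j)| = ∏ j ∈ range m, c j := by
  rw [Finset.abs_prod, Finset.prod_range]
  refine Finset.prod_congr rfl fun j _ => ?_
  simp [abs_of_nonneg (hc j)]

theorem prod_desc (x i : ℕ) : ∏ l ∈ range i, ((x : ℚ) - l) = (i.factorial : ℚ) * x.choose i := by
  rw [← Nat.cast_mul, ← Nat.descFactorial_eq_factorial_mul_choose]
  induction i with
  | zero => simp
  | succ i ih =>
    rw [Finset.prod_range_succ, ih, Nat.descFactorial_succ]
    rcases le_or_gt i x with h | h
    · push_cast [h]
      ring
    · rw [Nat.descFactorial_of_lt h]; simp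

theorem prod_desc_rev (N x j : ℕ) (hx : x < N) :
    ∏ l ∈ range j, ((x : ℚ) - ((N : ℚ) - 1 - l)) =
      (-1) ^ j * (j.factorial : ℚ) * (N - 1 - x).choose j := by
  rw [mul_assoc, ← prod_desc]
  have : ((N - 1 - x : ℕ) : ℚ) = (N : ℚ) - 1 - x := by
    rw [Nat.cast_sub (by omega), Nat.cast_sub (by omega)]; simp
  rw [this]
  have h2 : ((-1 : ℚ)) ^ j = ∏ l ∈ range j, (-1 : ℚ) := by simp
  rw [h2, ← Finset.prod_mul_distrib]
  refine Finset.prod_congr rfl fun l _ => ?_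
  ring

theorem prod_asc (x i : ℕ) : ∏ l ∈ range i, ((x : ℚ) - (-(1 + (l : ℚ)))) =
    (i.factorial : ℚ) * (x + i).choose i := by
  rw [← Nat.cast_mul, ← Nat.ascFactorial_eq_factorial_mul_choose, Nat.ascFactorial_eq_prod_range]
  push_cast
  refine Finset.prod_congr rfl fun l _ => ?_
  ring

def Hd (m : ℕ) : ℚ := |Matrix.det (Matrix.of fun i j : Fin m => ((2 * m).choose (i + j + 1) : ℚ))|

theorem fact_nonneg (i : ℕ) : 0 ≤ (i.factorial : ℚ) := by positivity

theorem choose_fact (N i j : ℕ) (h : j < N) : ((N + i).choose (i + j + 1) : ℚ) =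
    ((N + i).factorial : ℚ) * ((N - 1 - j).factorial : ℚ)⁻¹ * ((i + j + 1).factorial : ℚ)⁻¹ := by
  rw [Nat.cast_choose ℚ (by omega), show N + i - (i + j + 1) = N - 1 - j by omega]
  have := Nat.factorial_ne_zero (N - 1 - j)
  have := Nat.factorial_ne_zero (i + j + 1)
  field_simp

open scoped Classical in
theorem B1 (m : ℕ) : ∑ z : {z : Fin m → Fin (2 * m) // StrictMono z},
      Matrix.det (Matrix.vandermonde (fun k => ((z.1 k : ℕ) : ℚ))) ^ 2 =
      (∏ i ∈ range m, (i.factorial : ℚ)) ^ 2 * Hd m := by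
  have h := V_sum (m := m) (N := 2 * m) (fun _ => 1) (fun x => x) (fun l => l)
    (fun l => ((2 * m : ℕ) : ℚ) - 1 - l)
  simp only [Finset.prod_const_one, one_mul] at h
  rw [h, ← abs_of_nonneg (a := Matrix.det _) (by rw [← h]; positivity)]
  have h2 := abs_det_scale (m := m) (fun i => (Nat.factorial i : ℚ))
    (fun j => (-1) ^ (j : ℕ) * (Nat.factorial j : ℚ)) (fun i j => ((2 * m).choose (i + j + 1) : ℚ))
  rw [abs_prod_pos (fun i => (Nat.factorial i : ℚ)) fact_nonneg,
    abs_prod_neg_one (fun i => (Nat.factorial i : ℚ)) fact_nonneg] at h2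
  rw [Hd, sq, ← h2]
  congr 3
  ext i j
  rw [← sum_range_choose1]
  push_cast
  rw [Finset.mul_sum]
  refine Finset.sum_congr rfl fun x hx => ?_
  have := prod_desc_rev (2 * m) x j (by simpa using hx)
  push_cast at this
  rw [prod_desc, this]
  ring

open scoped Classical in
theorem B2 (m : ℕ) : ∑ z : {z : Fin m → Fin (2 * m) // StrictMono z},
      Matrix.det (Matrix.vandermonde (fun k => ((z.1 k : ℕ) : ℚ))) ^ 2 =
      (∏ i ∈ range m, (i.factorial : ℚ)) ^ 2 *
      |Matrix.det (Matrix.of fun i j : Fin m => ((2 * m + i).choose (i + j + 1) : ℚ))| := by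
  have h := V_sum (m := m) (N := 2 * m) (fun _ => 1) (fun x => x) (fun l => -(1 + (l : ℚ)))
    (fun l => ((2 * m : ℕ) : ℚ) - 1 - l)
  simp only [Finset.prod_const_one, one_mul] at h
  rw [h, ← abs_of_nonneg (a := Matrix.det _) (by rw [← h]; positivity)]
  have h2 := abs_det_scale (m := m) (fun i => (Nat.factorial i : ℚ))
    (fun j => (-1) ^ (j : ℕ) * (Nat.factorial j : ℚ))
    (fun i j => ((2 * m + i).choose (i + j + 1) : ℚ))
  rw [abs_prod_pos (fun i => (Nat.factorial i : ℚ)) fact_nonneg,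
    abs_prod_neg_one (fun i => (Nat.factorial i : ℚ)) fact_nonneg] at h2
  rw [sq, ← h2]
  congr 3
  ext i j
  rw [← sum_range_choose2]
  push_cast
  rw [Finset.mul_sum]
  refine Finset.sum_congr rfl fun x hx => ?_
  have := prod_desc_rev (2 * m) x j (by simpa using hx)
  push_cast at this
  rw [prod_asc, this]
  ring

theorem det_vand_id (m : ℕ) : Matrix.det (Matrix.vandermonde (fun i : Fin m => ((i : ℕ) : ℚ))) =
    ∏ i ∈ range m, (i.factorial : ℚ) := by
  cases m with
  | zero => simp
  | succ n =>
    rw [Matrix.det_vandermonde_id_eq_superFactorial, ← Nat.prod_range_factorial_succ,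
      Finset.prod_range_succ', Nat.cast_prod]
    simp

theorem B3a (m : ℕ) :
    |Matrix.det (Matrix.of fun i j : Fin m => ((i + j + 1 : ℕ).factorial : ℚ)⁻¹)| =
      ∏ i ∈ range m, ((i.factorial : ℚ) * ((m + i).factorial : ℚ)⁻¹) := by
  have h2 := abs_det_scale (m := m) (fun _ => 1) (fun j => ((m + j).factorial : ℚ)⁻¹)
    (fun i j => ∏ l ∈ range (Fin.rev i), (((j : ℕ) : ℚ) + m - l))
  rw [abs_prod_pos (fun i => ((m + i).factorial : ℚ)⁻¹) (by intro i; positivity)] at h2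
  have h3 : |Matrix.det (Matrix.of (fun i j : Fin m => 
      ∏ l ∈ range (Fin.rev i), (((j : ℕ) : ℚ) + m - l)))| = ∏ i ∈ range m, (i.factorial : ℚ) := by
    have h4 := Matrix.abs_det_submatrix_equiv_equiv Fin.revPerm (Equiv.refl _)
      (Matrix.of (fun i j : Fin m => ∏ l ∈ range i, (((j : ℕ) : ℚ) + m - l)))
    rw [det_monic (fun l => (l : ℚ)) (fun j : Fin m => ((j : ℕ) : ℚ) + m),
      Matrix.det_vandermonde_add, det_vand_id] at h4
    rw [abs_of_nonneg (a := ∏ i ∈ range m, (i.factorial : ℚ)) (by positivity)] at h4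
    rw [← h4]
    rfl
  rw [h3] at h2
  rw [Finset.prod_mul_distrib]
  simp only [Finset.prod_const_one, abs_one, one_mul] at h2
  rw [mul_comm, ← h2]
  congr 3
  ext i j
  have h5 := prod_desc (m + j) (Fin.rev i)
  have hh : m + j - (Fin.rev i : ℕ) = i + j + 1 := by
    rw [Fin.val_rev]; omega
  rw [Nat.cast_choose ℚ (by rw [Fin.val_rev]; omega), hh] at h5
  have : ∏ l ∈ range (Fin.rev i), (((j : ℕ) : ℚ) + m - l) =
    ∏ l ∈ range (Fin.rev i), (((m + j : ℕ) : ℚ) - l) := by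
    push_cast
    simp only [add_comm]
  rw [this, h5]
  have := Nat.factorial_ne_zero (m + j)
  have := Nat.factorial_ne_zero (i + j + 1)
  have := Nat.factorial_ne_zero (Fin.rev i)
  field_simp

theorem prod_rev_fact (m : ℕ) : ∏ i ∈ range m, ((2 * m - 1 - i).factorial : ℚ) =
    ∏ i ∈ range m, ((m + i).factorial : ℚ) := by
  rw [← Finset.prod_range_reflect]
  refine Finset.prod_congr rfl fun i hi => ?_
  rw [Finset.mem_range] at hi
  congr 2
  omega

theorem B3 (m : ℕ) :
    |Matrix.det (Matrix.of fun i j : Fin m => ((2 * m + i).choose (i + j + 1) : ℚ))| =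
    ∏ i ∈ range m, (i.factorial : ℚ) * ((i + 2 * m).factorial : ℚ) / ((i + m).factorial : ℚ) ^ 2 := by
  have h2 := abs_det_scale (m := m) (fun i => ((2 * m + i).factorial : ℚ))
    (fun j => ((2 * m - 1 - j).factorial : ℚ)⁻¹) (fun i j => ((i + j + 1 : ℕ).factorial : ℚ)⁻¹)
  rw [abs_prod_pos (fun i => ((2 * m + i).factorial : ℚ)) (by intro i; positivity), 
    abs_prod_pos (fun i => ((2 * m - 1 - i).factorial : ℚ)⁻¹) (by intro i; positivity), B3a,
    Finset.prod_inv_distrib, prod_rev_fact, ← Finset.prod_inv_distrib, ← Finset.prod_mul_distrib,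
    ← Finset.prod_mul_distrib] at h2
  have h3 : (Matrix.of fun i j : Fin m => ((2 * m + i).choose (i + j + 1) : ℚ)) = 
    (Matrix.of fun i j : Fin m => ((2 * m + i).factorial : ℚ) * ((2 * m - 1 - j).factorial : ℚ)⁻¹ *
      ((i + j + 1 : ℕ).factorial : ℚ)⁻¹) := by
    ext i j
    exact choose_fact _ _ _ (by omega)
  rw [h3, h2]
  refine Finset.prod_congr rfl fun i _ => ?_
  rw [add_comm i, add_comm i]
  field_simp

theorem Hd_eq (m : ℕ) : Hd m =
    ∏ i ∈ range m, (i.factorial : ℚ) * ((i + 2 * m).factorial : ℚ) / ((i + m).factorial : ℚ) ^ 2 := by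
  have h1 := B1 m
  rw [B2, B3] at h1
  refine (mul_left_cancel₀ ?_ h1).symm
  have : 0 < ∏ i ∈ range m, (i.factorial : ℚ) := Finset.prod_pos fun i _ => by positivity
  positivity

/-! The sum `S(i,j)` -/

theorem F_rel (z : ℚ) (i : ℕ) :
    z ^ 2 * ∏ k ∈ range i, (z ^ 2 - ((k : ℚ) + 1) ^ 2) =
      z * (z - i) * ∏ k ∈ range i, (z * (z + 1) - k * (k + 1)) ∧
    (z + 1) ^ 2 * ∏ k ∈ range i, ((z + 1) ^ 2 - ((k : ℚ) + 1) ^ 2) =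
      (z + 1) * (z + 1 + i) * ∏ k ∈ range i, (z * (z + 1) - k * (k + 1)) := by
  induction i with
  | zero => constructor <;> simp <;> ring
  | succ i ih =>
    simp only [Finset.prod_range_succ]
    push_cast
    constructor
    · rw [← mul_assoc, ih.1]; ring
    · rw [← mul_assoc, ih.2]; ring

theorem S_base_aux (N i : ℕ) :
    ((i : ℚ) + 1) * ∑ z ∈ range N, (2 * (z : ℚ) + 1) * ∏ k ∈ range i, ((z : ℚ) * (z + 1) - k * (k + 1)) =
      (N : ℚ) ^ 2 * ∏ k ∈ range i, ((N : ℚ) ^ 2 - ((k : ℚ) + 1) ^ 2) := by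
  induction N with
  | zero => simp
  | succ N ih =>
    rw [Finset.sum_range_succ, mul_add, ih, (F_rel N i).1]
    push_cast
    rw [(F_rel N i).2]
    ring

theorem F_fact (i r N : ℕ) (hN : N = i + 1 + r) : (N : ℚ) ^ 2 *
    (∏ k ∈ range i, ((N : ℚ) ^ 2 - ((k : ℚ) + 1) ^ 2)) * (r.factorial : ℚ) =
     (N : ℚ) * ((N + i).factorial : ℚ) := by
  induction i generalizing r with
  | zero =>
    have : N = r + 1 := by omega
    subst this
    simp [Nat.factorial_succ]
    ring
  | succ i ih =>
    have h := ih (r + 1) (by omega)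
    have hr : (r : ℚ) = N - i - 2 := by subst hN; push_cast; ring
    rw [Finset.prod_range_succ, ← add_assoc, Nat.factorial_succ (N + i)]
    rw [Nat.factorial_succ] at h
    push_cast at h ⊢
    rw [hr] at h
    linear_combination ((N : ℚ) + i + 1) * h

noncomputable def S (N i j : ℕ) : ℚ := ∑ z ∈ range N, (2 * (z : ℚ) + 1) *
  (∏ k ∈ range i, ((z : ℚ) * (z + 1) - k * (k + 1))) *
  ∏ k ∈ range j, ((z : ℚ) * (z + 1) - ((N : ℚ) - 1 - k) * ((N : ℚ) - k))

theorem S_rec (N i j : ℕ) : S N i (j + 1) = S N (i + 1) j - 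
    ((N : ℚ) - i - j - 1) * ((N : ℚ) + i - j) * S N i j := by
  unfold S
  rw [Finset.mul_sum, ← Finset.sum_sub_distrib]
  refine Finset.sum_congr rfl fun z _ => ?_
  rw [Finset.prod_range_succ, Finset.prod_range_succ]
  ring

theorem S_eq (i j r N : ℕ) (hN : N = i + j + 1 + r) :
    ((i + j + 1).factorial : ℚ) * ((i + r).factorial : ℚ) * (r.factorial : ℚ) * S N i j =
      (-1) ^ j * (i.factorial : ℚ) * (j.factorial : ℚ) * ((N + i).factorial : ℚ) *
        (N.factorial : ℚ) := by
  induction j generalizing i r with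
  | zero =>
    have h1 := S_base_aux N i
    have h2 := F_fact i r N (by omega)
    have h3 : S N i 0 = ∑ z ∈ range N, (2 * (z : ℚ) + 1) *
        ∏ k ∈ range i, ((z : ℚ) * (z + 1) - k * (k + 1)) := by simp [S]
    rw [← h3] at h1
    have h4 : N = i + r + 1 := by omega
    have h5 : (N : ℚ) = i + r + 1 := by subst h4; push_cast; ring
    have h6 : (N.factorial : ℚ) = N * ((i + r).factorial : ℚ) := by
      rw [h4, Nat.factorial_succ]; push_cast; ring
    rw [h6]
    simp only [Nat.add_zero, Nat.factorial_succ, pow_zero, Nat.factorial_zero]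
    push_cast
    rw [← h1] at h2
    linear_combination (i.factorial : ℚ) * ((i + r).factorial : ℚ) * h2
  | succ j ih =>
    have h1 := ih (i + 1) r (by omega)
    have h2 := ih i (r + 1) (by omega)
    rw [S_rec]
    have hN' : (N : ℚ) = i + j + 2 + r := by subst hN; push_cast; ring
    rw [show i + 1 + j + 1 = i + j + 1 + 1 by ring, show i + 1 + r = i + r + 1 by ring,
      ← add_assoc N] at h1
    rw [show i + (r + 1) = i + r + 1 by ring] at h2
    rw [show i + (j + 1) + 1 = i + j + 1 + 1 by ring]
    simp only [Nat.factorial_succ, pow_succ] at h1 h2 ⊢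
    have hne : ((i : ℚ) + r + 1) ≠ 0 := by positivity
    apply mul_left_cancel₀ hne
    push_cast at h1 h2 ⊢
    rw [hN'] at h1 ⊢
    linear_combination h1 - ((i : ℚ) + j + 2) * (2 * i + r + 2) * h2

theorem S_choose (N i j : ℕ) (h : i + j < N) :
    S N i j = ((i.factorial : ℚ) * ((N + i).factorial : ℚ)) *
      ((-1) ^ j * ((j.factorial : ℚ) * ((N - 1 - j).factorial : ℚ)⁻¹)) * (N.choose (i + j + 1) : ℚ) := by
  obtain ⟨r, hr⟩ := Nat.exists_eq_add_of_lt h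
  have h1 := S_eq i j r N (by omega)
  rw [Nat.cast_choose ℚ (by omega), show N - (i + j + 1) = r by omega,
    show N - 1 - j = i + r by omega]
  have := Nat.factorial_ne_zero (i + r)
  have := Nat.factorial_ne_zero (i + j + 1)
  have := Nat.factorial_ne_zero r
  field_simp
  linear_combination h1

open scoped Classical in
theorem B4 (m : ℕ) : ∑ z : {z : Fin m → Fin (2 * m) // StrictMono z},
      (∏ k, (2 * ((z.1 k : ℕ) : ℚ) + 1)) * Matrix.det (Matrix.vandermonde
        (fun k => ((z.1 k : ℕ) : ℚ) * ((z.1 k : ℕ) + 1))) ^ 2 =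
      (∏ i ∈ range m, (i.factorial : ℚ) * ((i + m).factorial : ℚ)) * Hd m ^ 2 := by
  have h := V_sum (m := m) (N := 2 * m) (fun x => 2 * (x : ℚ) + 1) (fun x => (x : ℚ) * (x + 1))
    (fun l => (l : ℚ) * (l + 1))
    (fun l => (((2 * m : ℕ) : ℚ) - 1 - l) * (((2 * m : ℕ) : ℚ) - l))
  rw [h, ← abs_of_nonneg (a := Matrix.det _) (by rw [← h]; positivity)]
  have h2 := abs_det_scale (m := m) (fun i => (Nat.factorial i : ℚ) * ((2 * m + i).factorial : ℚ))
    (fun j => (-1) ^ (j : ℕ) * ((Nat.factorial j : ℚ) * ((2 * m - 1 - j).factorial : ℚ)⁻¹))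
    (fun i j => ((2 * m).choose (i + j + 1) : ℚ))
  rw [abs_prod_pos (fun i => (Nat.factorial i : ℚ) * ((2 * m + i).factorial : ℚ))
      (by intro i; positivity),
    abs_prod_neg_one (fun i => (Nat.factorial i : ℚ) * ((2 * m - 1 - i).factorial : ℚ)⁻¹)
      (by intro i; positivity)] at h2
  have h3 : |Matrix.det (Matrix.of fun i j : Fin m => S (2 * m) i j)| =
      (∏ i ∈ range m, (i.factorial : ℚ) * ((i + m).factorial : ℚ)) * Hd m ^ 2 := by
    simp_rw [fun i j : Fin m => S_choose (2 * m) i j (by omega)]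
    rw [h2, ← Hd, sq, ← mul_assoc]
    congr 1
    rw [Finset.prod_mul_distrib, Finset.prod_mul_distrib, Finset.prod_inv_distrib, prod_rev_fact,
      ← Finset.prod_inv_distrib, ← Finset.prod_mul_distrib, ← Finset.prod_mul_distrib,
      ← Finset.prod_mul_distrib, Hd_eq, ← Finset.prod_mul_distrib]
    refine Finset.prod_congr rfl fun i _ => ?_
    rw [add_comm i, add_comm i]
    field_simp
  rw [← h3]
  rfl




def T : (n : ℕ) → (Fin n → ℕ) → ℕ
  | 0, _ => 1
  | n + 1, x => ∑ y ∈ Fintype.piFinset (fun i : Fin n => Finset.Icc (x i.castSucc) (x i.succ)), T n y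

theorem sum_Icc_choose' (a b c j : ℕ) (h : a ≤ b) :
    ∑ y ∈ Finset.Icc a b, ((y + c).choose j : ℚ) =
      ((b + (c + 1)).choose (j + 1) : ℚ) - ((a + c).choose (j + 1) : ℚ) := by
  induction b, h using Nat.le_induction with
  | base => 
    simp only [Finset.Icc_self, Finset.sum_singleton]
    rw [← add_assoc, Nat.choose_succ_succ]
    push_cast; ring
  | succ b hb ih =>
    rw [← Finset.insert_Icc_right_eq_Icc_add_one (by omega), Finset.sum_insert (by simp), ih,
      show b + 1 + (c + 1) = (b + (c + 1)) + 1 by ring, Nat.choose_succ_succ (b + (c + 1)),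
      show b + 1 + c = b + (c + 1) by ring]
    push_cast; ring

theorem T_det (n : ℕ) (x : Fin n → ℕ) (hx : Monotone x) :
    (T n x : ℚ) = Matrix.det (Matrix.of fun i j : Fin n => ((x i + i).choose j : ℚ)) := by
  induction n with
  | zero => simp [T]
  | succ n ih =>
    rw [T]
    push_cast
    have h1 : ∀ y ∈ Fintype.piFinset (fun i : Fin n => Finset.Icc (x i.castSucc) (x i.succ)),
        (T n y : ℚ) = Matrix.det (Matrix.of fun i j : Fin n => ((y i + i).choose j : ℚ)) := by
      intro y hy
      apply ih
      simp only [Fintype.mem_piFinset, Finset.mem_Icc] at hy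
      intro a b hab
      rcases hab.lt_or_eq with h | h
      · refine (hy a).2.trans (le_trans (hx ?_) (hy b).1)
        rw [Fin.le_def]
        simpa using h
      · rw [h]
    rw [Finset.sum_congr rfl h1,
      ← det_pi_sum _ (fun (i : Fin n) (y : ℕ) (j : Fin n) => ((y + i).choose j : ℚ))]
    have h2 := Matrix.det_eq_of_forall_row_eq_smul_add_pred
      (A := Matrix.of fun i j : Fin (n + 1) => ((x i + i).choose j : ℚ))
      (B := Matrix.of fun (i j : Fin (n + 1)) => Fin.cases (motive := fun _ => ℚ) ((x 0).choose j : ℚ)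
        (fun i => ((x i.succ + i.succ).choose j : ℚ) - ((x i.castSucc + i.castSucc).choose j : ℚ)) i)
      (fun _ => 1) (by simp) (by intro i j; simp)
    rw [h2, Matrix.det_succ_column_zero, Fin.sum_univ_succ]
    simp only [Matrix.of_apply, Fin.cases_zero, Fin.cases_succ]
    simp only [Fin.val_zero, Nat.choose_zero_right, sub_self, Nat.cast_one]
    simp only [mul_zero, zero_mul, Finset.sum_const_zero, add_zero, pow_zero, one_mul]
    congr 1
    ext i j
    simp only [Matrix.of_apply, Matrix.submatrix_apply, Fin.succAbove_zero, Fin.cases_succ]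
    rw [sum_Icc_choose' _ _ _ _ (hx (by simp [Fin.le_def]))]
    simp

theorem T_vand (n : ℕ) (x : Fin n → ℕ) (hx : Monotone x) :
    (T n x : ℚ) * ∏ i ∈ range n, (i.factorial : ℚ) =
      Matrix.det (Matrix.vandermonde (fun i : Fin n => ((x i + i : ℕ) : ℚ))) := by
  rw [T_det n x hx, ← det_monic (fun l => (l : ℚ)), ← Matrix.det_transpose, mul_comm,
    Finset.prod_range, ← Matrix.det_mul_column]
  congr 1
  ext i j
  simp only [Matrix.of_apply, prod_desc, Matrix.transpose_apply]

/-! Gelfand-Tsetlin triangles -/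

abbrev Tri (n : ℕ) := {p : Fin n × Fin n // p.1 ≤ p.2}

abbrev GT (n : ℕ) (x : Fin n → ℕ) :=
  {f : Tri n → ℕ // Monotone f ∧ ∀ i, f ⟨(i, i), le_refl i⟩ = x i}

abbrev MU (n : ℕ) (x : Fin (n + 1) → ℕ) :=
  {y : Fin n → ℕ // y ∈ Fintype.piFinset
    (fun i : Fin n => Finset.Icc (x i.castSucc) (x i.succ))}

def up {n : ℕ} (p : Tri n) : Tri (n + 1) := ⟨(p.1.1.castSucc, p.1.2.succ), by
  have := p.2
  rw [Fin.le_def] at this ⊢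
  simp
  omega⟩

theorem up_mono {n : ℕ} : Monotone (up (n := n)) := by
  intro p q h
  refine ⟨?_, ?_⟩
  · exact h.1
  · exact Fin.succ_le_succ_iff.2 h.2

def step {n : ℕ} (x : Fin (n + 1) → ℕ) (f : GT (n + 1) x) : Σ y : MU n x, GT n y.1 :=
  ⟨⟨fun i => f.1 (up ⟨(i, i), le_refl i⟩), by
    simp only [Fintype.mem_piFinset, Finset.mem_Icc]
    intro i
    rw [← f.2.2, ← f.2.2]
    constructor
    · apply f.2.1
      exact ⟨le_refl _, by simp [up, Fin.le_def]⟩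
    · apply f.2.1
      exact ⟨by simp [up, Fin.le_def], le_refl _⟩⟩, 
    ⟨fun p => f.1 (up p), f.2.1.comp up_mono, fun i => rfl⟩⟩

theorem sigma_ext {n : ℕ} {P : (Fin n → ℕ) → Prop} (s t : Σ y : {y // P y}, GT n y.1)
    (h : s.2.1 = t.2.1) : s = t := by
  obtain ⟨⟨y, hy⟩, ⟨g, hg, hd⟩⟩ := s
  obtain ⟨⟨y', hy'⟩, ⟨g', hg', hd'⟩⟩ := t
  simp only at h
  subst h
  have : y = y' := by
    funext i
    exact (hd i).symm.trans (hd' i)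
  subst this
  rfl

def unstep {n : ℕ} (x : Fin (n + 1) → ℕ) (g : Tri n → ℕ) (p : Tri (n + 1)) : ℕ :=
  if h : p.1.1 < p.1.2 then g ⟨(⟨p.1.1, by have := p.1.2.2; rw [Fin.lt_def] at h; omega⟩,
    ⟨p.1.2 - 1, by have := p.1.2.2; rw [Fin.lt_def] at h; omega⟩), by
      rw [Fin.lt_def] at h; rw [Fin.le_def]; simp; omega⟩ else x p.1.1

theorem step_bij {n : ℕ} (x : Fin (n + 1) → ℕ) (hx : Monotone x) :
    Function.Bijective (step x) := by
  constructor
  · rintro ⟨f, hf, hd⟩ ⟨f', hf', hd'⟩ h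
    have h1 : (step x ⟨f, hf, hd⟩).2.1 = (step x ⟨f', hf', hd'⟩).2.1 := by rw [h]
    apply Subtype.ext
    funext ⟨⟨i, j⟩, hij⟩
    rcases hij.lt_or_eq with hlt | heq
    · have hlt' : (i : ℕ) < j := hlt
      let q : Tri n := ⟨(⟨i, by omega⟩, ⟨j - 1, by omega⟩), by
        rw [Fin.le_def]; simp; omega⟩
      have hq : up q = ⟨(i, j), hij⟩ := by
        refine Subtype.ext (Prod.ext (Fin.ext rfl) (Fin.ext ?_))
        simp [up, q]
        omega
      have := congrFun h1 q
      simp only [step, hq] at this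
      exact this
    · simp only at heq
      subst heq
      simp only [hd, hd']
  · rintro ⟨⟨y, hy⟩, ⟨g, hg, hd⟩⟩
    simp only [Fintype.mem_piFinset, Finset.mem_Icc] at hy
    refine ⟨⟨unstep x g, ?_, ?_⟩, ?_⟩
    · rintro ⟨⟨i, j⟩, hij⟩ ⟨⟨i', j'⟩, hij'⟩ ⟨h1, h2⟩
      simp only at h1 h2 hij hij'
      have key : ∀ (a b : Fin n) (h : a ≤ b), y a ≤ g ⟨(a, b), h⟩ ∧ g ⟨(a, b), h⟩ ≤ y b := by
        intro a b h
        have ha : g ⟨(a, a), le_refl a⟩ = y a := hd a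
        have hb : g ⟨(b, b), le_refl b⟩ = y b := hd b
        rw [← ha, ← hb]
        exact ⟨hg ⟨le_refl _, h⟩, hg ⟨h, le_refl _⟩⟩
      unfold unstep
      split_ifs with ha hb hb
      · apply hg
        refine ⟨h1, ?_⟩
        rw [Fin.le_def]
        simp only
        rw [Fin.le_def] at h2
        omega
      · simp only at ha hb
        refine (key _ _ _).2.trans ((hy _).2.trans (hx ?_))
        rw [Fin.lt_def] at ha hb
        rw [Fin.le_def] at *
        simp
        omega
      · simp only at ha hb
        refine le_trans ?_ (key _ _ _).1
        refine le_trans (hx ?_) (hy _).1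
        exact h1
      · exact hx h1
    · intro i
      simp [unstep]
    · apply sigma_ext
      funext ⟨⟨i, j⟩, hij⟩
      simp only [step, unstep, up]
      rw [dif_pos]
      · simp
      · simp only at hij
        rw [Fin.le_def] at hij
        rw [Fin.lt_def]
        simp
        omega

theorem MU_mono {n : ℕ} (x : Fin (n + 1) → ℕ) (hx : Monotone x) (y : MU n x) : Monotone y.1 := by
  obtain ⟨y, hy⟩ := y
  simp only [Fintype.mem_piFinset, Finset.mem_Icc] at hy
  intro a b hab
  rcases hab.lt_or_eq with h | h
  · refine (hy a).2.trans (le_trans (hx ?_) (hy b).1)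
    rw [Fin.le_def]
    simpa using h
  · rw [h]

theorem GT_card (n : ℕ) (x : Fin n → ℕ) (hx : Monotone x) :
    Finite (GT n x) ∧ Nat.card (GT n x) = T n x := by
  induction n with
  | zero =>
    have : Unique (GT 0 x) := by
      refine ⟨⟨⟨fun p => p.1.1.elim0, fun p => p.1.1.elim0, fun i => i.elim0⟩⟩, ?_⟩
      rintro ⟨f, hf⟩
      apply Subtype.ext
      funext p
      exact p.1.1.elim0
    exact ⟨inferInstance, by simp [T]⟩
  | succ n ih =>
    let e := Equiv.ofBijective _ (step_bij x hx)
    have hfin : ∀ y : MU n x, Finite (GT n y.1) := fun y => (ih y.1 (MU_mono x hx y)).1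
    have : Finite (Σ y : MU n x, GT n y.1) := inferInstance
    refine ⟨Finite.of_equiv _ e.symm, ?_⟩
    rw [Nat.card_congr e, Nat.card_sigma, T]
    exact (Finset.sum_congr rfl fun y _ => (ih y.1 (MU_mono x hx y)).2).trans
      (Finset.sum_coe_sort _ (T n))




abbrev Ht (n : ℕ) := {r : Fin n × Fin n → ℕ // Monotone r ∧ ∀ p, r p ≤ n}

abbrev HtS (n : ℕ) := {r : Fin n × Fin n → ℕ // Monotone r ∧
  ∀ i j : Fin n, r (i, j) + r (i.rev, j.rev) = n}

def toSet {n : ℕ} (r : Fin n × Fin n → ℕ) : Set (Fin n × Fin n × Fin n) :=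
  {p | r (p.1, p.2.1) + (p.2.2 : ℕ) < n}

theorem toSet_lower {n : ℕ} (r : Fin n × Fin n → ℕ) (hr : Monotone r) : IsLowerSet (toSet r) := by
  rintro ⟨i, j, k⟩ ⟨i', j', k'⟩ ⟨h1, h2, h3⟩ h
  simp only [toSet, Set.mem_ofPred_eq] at h ⊢
  have : r (i', j') ≤ r (i, j) := hr ⟨h1, h2⟩
  have h3 : (k' : ℕ) ≤ k := h3
  omega

theorem toSet_inj {n : ℕ} (r s : Fin n × Fin n → ℕ) (hr : ∀ p, r p ≤ n) (hs : ∀ p, s p ≤ n)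
    (h : toSet r = toSet s) : r = s := by
  funext ⟨i, j⟩
  have h1 : ∀ k : Fin n, (r (i, j) + (k : ℕ) < n ↔ s (i, j) + (k : ℕ) < n) := by
    intro k
    have := Set.ext_iff.1 h (i, j, k)
    exact this
  have hr := hr (i, j)
  have hs := hs (i, j)
  rcases lt_trichotomy (r (i, j)) (s (i, j)) with hlt | heq | hlt
  · have := h1 ⟨n - s (i, j), by omega⟩
    simp only at this
    omega
  · exact heq
  · have := h1 ⟨n - r (i, j), by omega⟩
    simp only at this
    omega

theorem exists_height {n : ℕ} (L : Set (Fin n)) (hL : IsLowerSet L) :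
    ∃ r ≤ n, ∀ k : Fin n, k ∈ L ↔ r + (k : ℕ) < n := by
  classical
  have hex : ∃ c : ℕ, ∀ k : Fin n, k ∈ L → (k : ℕ) < c := ⟨n, fun k _ => k.2⟩
  refine ⟨n - Nat.find hex, by omega, fun k => ?_⟩
  have hle : Nat.find hex ≤ n := Nat.find_min' hex fun k _ => k.2
  constructor
  · intro hk
    have := Nat.find_spec hex k hk
    omega
  · intro hk
    have := Nat.find_min hex (m := k) (by omega)
    push Not at this
    obtain ⟨k', hk', hle'⟩ := this
    exact hL (show k ≤ k' from hle') hk'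

theorem toSet_surj {n : ℕ} (S : Set (Fin n × Fin n × Fin n)) (hS : IsLowerSet S) :
    ∃ r : Fin n × Fin n → ℕ, Monotone r ∧ (∀ p, r p ≤ n) ∧ toSet r = S := by
  have : ∀ p : Fin n × Fin n, ∃ r ≤ n, ∀ k : Fin n, (p.1, p.2, k) ∈ S ↔ r + (k : ℕ) < n := by
    intro p
    apply exists_height {k | (p.1, p.2, k) ∈ S}
    intro k k' h hk
    exact hS (show (p.1, p.2, k') ≤ (p.1, p.2, k) from ⟨le_refl _, le_refl _, h⟩) hk
  choose r hr1 hr2 using this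
  refine ⟨r, ?_, hr1, ?_⟩
  · intro p q hpq
    by_contra hlt
    push Not at hlt
    have hp := hr1 p
    have h1 := (hr2 q ⟨n - r p, by omega⟩).2 (by simp only; omega)
    have h2 : (p.1, p.2, (⟨n - r p, by omega⟩ : Fin n)) ∈ S :=
      hS (a := (q.1, q.2, (⟨n - r p, by omega⟩ : Fin n))) ⟨hpq.1, hpq.2, le_refl _⟩ h1
    rw [hr2] at h2
    simp only at h2
    omega
  · ext ⟨i, j, k⟩
    exact (hr2 (i, j) k).symm

theorem toSet_sc {n : ℕ} (r : Fin n × Fin n → ℕ) (hr : ∀ p, r p ≤ n) :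
    (∀ i j k : Fin n, (i, j, k) ∈ toSet r ↔ (i.rev, j.rev, k.rev) ∉ toSet r) ↔
      ∀ i j : Fin n, r (i, j) + r (i.rev, j.rev) = n := by
  simp only [toSet, Set.mem_ofPred_eq, Fin.val_rev]
  constructor
  · intro h i j
    have h1 := hr (i, j)
    have h2 := hr (i.rev, j.rev)
    rcases lt_trichotomy (r (i, j) + r (i.rev, j.rev)) n with hlt | heq | hlt
    · have := h i j ⟨r (i.rev, j.rev), by omega⟩
      simp only at this
      omega
    · exact heq
    · have := h i j ⟨n - r (i, j), by have := i.2; omega⟩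
      simp only at this
      omega
  · intro h i j k
    have := h i j
    have := k.2
    omega

theorem card_lower (n : ℕ) :
    Nat.card {S : Set (Fin n × Fin n × Fin n) // IsLowerSet S} = Nat.card (Ht n) := by
  symm
  refine Nat.card_congr (Equiv.ofBijective (fun r => ⟨toSet r.1, toSet_lower r.1 r.2.1⟩) ⟨?_, ?_⟩)
  · intro r s h
    exact Subtype.ext (toSet_inj _ _ r.2.2 s.2.2 (congrArg Subtype.val h))
  · rintro ⟨S, hS⟩
    obtain ⟨r, h1, h2, h3⟩ := toSet_surj S hS
    exact ⟨⟨r, h1, h2⟩, Subtype.ext h3⟩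

theorem HtS_le {n : ℕ} (r : HtS n) (p) : r.1 p ≤ n := by
  have := r.2.2 p.1 p.2
  change r.1 p + _ = n at this
  omega

theorem card_sc (n : ℕ) :
    Nat.card {S : Set (Fin n × Fin n × Fin n) // IsLowerSet S ∧
        ∀ i j k : Fin n, (i, j, k) ∈ S ↔ (i.rev, j.rev, k.rev) ∉ S} = Nat.card (HtS n) := by
  symm
  refine Nat.card_congr (Equiv.ofBijective (fun r => ⟨toSet r.1, toSet_lower r.1 r.2.1,
    (toSet_sc r.1 (HtS_le r)).2 r.2.2⟩) ⟨?_, ?_⟩)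
  · intro r s h
    exact Subtype.ext (toSet_inj _ _ (HtS_le r) (HtS_le s) (congrArg Subtype.val h))
  · rintro ⟨S, hS, hc⟩
    obtain ⟨r, h1, h2, h3⟩ := toSet_surj S hS
    subst h3
    exact ⟨⟨r, h1, (toSet_sc r h2).1 hc⟩, rfl⟩

/-! Diagonal decomposition -/

abbrev La (n : ℕ) := {x : Fin n → ℕ // Monotone x ∧ ∀ i, x i ≤ n}

abbrev LaS (n : ℕ) := {x : Fin n → ℕ // Monotone x ∧ ∀ i : Fin n, x i + x i.rev = n}

def glue {n : ℕ} (g h : Tri n → ℕ) (p : Fin n × Fin n) : ℕ :=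
  if hp : p.1 ≤ p.2 then g ⟨p, hp⟩ else h ⟨(p.2, p.1), (not_le.1 hp).le⟩

theorem glue_mono {n : ℕ} (g h : Tri n → ℕ) (hg : Monotone g) (hh : Monotone h)
    (hd : ∀ i, g ⟨(i, i), le_refl i⟩ = h ⟨(i, i), le_refl i⟩) : Monotone (glue g h) := by
  rintro ⟨i, j⟩ ⟨i', j'⟩ ⟨h1, h2⟩
  simp only at h1 h2
  unfold glue
  simp only
  split_ifs with ha hb hb
  · exact hg ⟨h1, h2⟩
  · push Not at hb
    refine le_trans (hg (b := ⟨(j', j'), le_refl _⟩) ⟨ha.trans h2, h2⟩) ?_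
    rw [hd]
    exact hh ⟨le_refl _, hb.le⟩
  · push Not at ha
    refine le_trans (hh (b := ⟨(i', i'), le_refl _⟩) ⟨ha.le.trans h1, h1⟩) ?_
    rw [← hd]
    exact hg ⟨le_refl _, hb⟩
  · exact hh ⟨h2, h1⟩

theorem glue_le {n : ℕ} (g h : Tri n → ℕ) (p : Tri n) : glue g h p.1 = g p := by
  simp [glue, p.2]

theorem glue_ge {n : ℕ} (g h : Tri n → ℕ)
    (hd : ∀ i, g ⟨(i, i), le_refl i⟩ = h ⟨(i, i), le_refl i⟩) (p : Tri n) :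
    glue g h (p.1.2, p.1.1) = h p := by
  obtain ⟨⟨i, j⟩, hp⟩ := p
  simp only at hp
  rcases hp.lt_or_eq with hlt | heq
  · simp [glue, not_le.2 hlt]
  · subst heq
    simp [glue, hd]

def upper {n : ℕ} {x : Fin n → ℕ} (r : Fin n × Fin n → ℕ) (hr : Monotone r)
    (hx : ∀ i, r (i, i) = x i) : GT n x :=
  ⟨fun p => r p.1, fun _ _ h => hr h, fun i => hx i⟩

def lower {n : ℕ} {x : Fin n → ℕ} (r : Fin n × Fin n → ℕ) (hr : Monotone r)
    (hx : ∀ i, r (i, i) = x i) : GT n x :=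
  ⟨fun p => r (p.1.2, p.1.1), fun _ _ h => hr ⟨h.2, h.1⟩, fun i => hx i⟩

def splitPP {n : ℕ} (r : Ht n) : Σ x : La n, GT n x.1 × GT n x.1 :=
  ⟨⟨fun i => r.1 (i, i), fun _ _ h => r.2.1 ⟨h, h⟩, fun _ => r.2.2 _⟩,
    upper r.1 r.2.1 fun _ => rfl, lower r.1 r.2.1 fun _ => rfl⟩

theorem sigma_ext2 {n : ℕ} {P : (Fin n → ℕ) → Prop} (s t : Σ y : {y // P y}, GT n y.1 × GT n y.1)
    (h : s.2.1.1 = t.2.1.1) (h2 : s.2.2.1 = t.2.2.1) : s = t := by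
  obtain ⟨⟨y, hy⟩, ⟨g, hg, hd⟩, ⟨k, hk, hkd⟩⟩ := s
  obtain ⟨⟨y', hy'⟩, ⟨g', hg', hd'⟩, ⟨k', hk', hkd'⟩⟩ := t
  simp only at h h2
  subst h
  subst h2
  have : y = y' := by
    funext i
    exact (hd i).symm.trans (hd' i)
  subst this
  rfl

theorem splitPP_bij (n : ℕ) : Function.Bijective (splitPP (n := n)) := by
  constructor
  · intro r s h
    have h1 : (splitPP r).2.1.1 = (splitPP s).2.1.1 := by rw [h]
    have h2 : (splitPP r).2.2.1 = (splitPP s).2.2.1 := by rw [h]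
    apply Subtype.ext
    funext ⟨i, j⟩
    rcases le_total i j with hij | hij
    · exact congrFun h1 ⟨(i, j), hij⟩
    · exact congrFun h2 ⟨(j, i), hij⟩
  · rintro ⟨⟨x, hx, hxn⟩, ⟨g, hg, hd⟩, ⟨k, hk, hkd⟩⟩
    have hdd : ∀ i, g ⟨(i, i), le_refl i⟩ = k ⟨(i, i), le_refl i⟩ :=
      fun i => (hd i).trans (hkd i).symm
    refine ⟨⟨glue g k, glue_mono g k hg hk hdd, ?_⟩, ?_⟩
    · rintro ⟨i, j⟩
      refine (glue_mono g k hg hk hdd (b := (max i j, max i j)) ⟨le_max_left _ _, le_max_right _ _⟩).trans ?_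
      have h3 := glue_le g k ⟨(max i j, max i j), le_refl _⟩
      simp only at h3
      rw [h3, hd]
      exact hxn _
    · apply sigma_ext2
      · funext p
        exact glue_le g k p
      · funext p
        exact glue_ge g k hdd p

def splitS {n : ℕ} (r : HtS n) : Σ x : LaS n, GT n x.1 :=
  ⟨⟨fun i => r.1 (i, i), fun _ _ h => r.2.1 ⟨h, h⟩, fun _ => r.2.2 _ _⟩,
    upper r.1 r.2.1 fun _ => rfl⟩

def revTri {n : ℕ} (p : Tri n) : Tri n := ⟨(p.1.2.rev, p.1.1.rev), Fin.rev_le_rev.2 p.2⟩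

theorem splitS_bij (n : ℕ) : Function.Bijective (splitS (n := n)) := by
  constructor
  · intro r s h
    have h1 : (splitS r).2.1 = (splitS s).2.1 := by rw [h]
    apply Subtype.ext
    funext ⟨i, j⟩
    rcases le_total i j with hij | hij
    · exact congrFun h1 ⟨(i, j), hij⟩
    · have h2 : r.1 (i.rev, j.rev) = s.1 (i.rev, j.rev) :=
        congrFun h1 ⟨(i.rev, j.rev), Fin.rev_le_rev.2 hij⟩
      have h3 := r.2.2 i j
      have h4 := s.2.2 i j
      omega
  · rintro ⟨⟨x, hx, hxn⟩, ⟨g, hg, hd⟩⟩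
    have hd : ∀ i, g ⟨(i, i), le_refl i⟩ = x i := hd
    have hgn : ∀ p, g p ≤ n := by
      intro p
      refine (hg (b := ⟨(p.1.2, p.1.2), le_refl _⟩) ⟨p.2, le_refl _⟩).trans ?_
      rw [hd]
      have := hxn p.1.2
      omega
    let k : Tri n → ℕ := fun p => n - g (revTri p)
    have hk : Monotone k := by
      intro p q h
      have : g (revTri q) ≤ g (revTri p) := hg ⟨Fin.rev_le_rev.2 h.2, Fin.rev_le_rev.2 h.1⟩
      simp only [k]
      omega
    have hdd : ∀ i, g ⟨(i, i), le_refl i⟩ = k ⟨(i, i), le_refl i⟩ := by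
      intro i
      simp only [k, revTri, hd]
      have := hxn i
      omega
    refine ⟨⟨glue g k, glue_mono g k hg hk hdd, ?_⟩, ?_⟩
    · have main : ∀ i j : Fin n, i ≤ j → glue g k (i, j) + glue g k (i.rev, j.rev) = n := by
        intro i j hij
        have h1 := glue_le g k ⟨(i, j), hij⟩
        have h2 := glue_ge g k hdd ⟨(j.rev, i.rev), Fin.rev_le_rev.2 hij⟩
        simp only at h1 h2
        rw [h1, h2]
        simp only [k, revTri, Fin.rev_rev]
        have := hgn ⟨(i, j), hij⟩
        omega
      intro i j
      rcases le_total i j with hij | hij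
      · exact main i j hij
      · have := main i.rev j.rev (Fin.rev_le_rev.2 hij)
        rw [Fin.rev_rev, Fin.rev_rev] at this
        omega
    · apply sigma_ext
      funext p
      exact glue_le g k p

abbrev Z (m N : ℕ) := {z : Fin m → Fin N // StrictMono z}

theorem Z_ge {m N : ℕ} (z : Z m N) (i : Fin m) : (i : ℕ) ≤ z.1 i := by
  obtain ⟨i, hi⟩ := i
  induction i with
  | zero => simp
  | succ i ih =>
    have h1 := ih (by omega)
    have h2 : z.1 ⟨i, by omega⟩ < z.1 ⟨i + 1, hi⟩ := z.2 (by simp)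
    rw [Fin.lt_def] at h2
    simp only at h1 ⊢
    omega

theorem Z_sub_mono {m N : ℕ} (z : Z m N) : Monotone (fun i : Fin m => (z.1 i : ℕ) - i) := by
  cases m with
  | zero => intro i; exact i.elim0
  | succ m =>
    rw [Fin.monotone_iff_le_succ]
    intro i
    have h2 : z.1 i.castSucc < z.1 i.succ := z.2 (by simp [Fin.lt_def])
    rw [Fin.lt_def] at h2
    simp
    omega

theorem Z_le {m d N : ℕ} (hN : N = m + d) (z : Z m N) (i : Fin m) : (z.1 i : ℕ) - i ≤ d := by
  have hm : 0 < m := by have := i.2; omega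
  have h := Z_sub_mono z (show i ≤ ⟨m - 1, by omega⟩ by rw [Fin.le_def]; simp; omega)
  simp only at h
  have := (z.1 ⟨m - 1, by omega⟩).2
  omega

def toLa (m : ℕ) (z : Z m (2 * m)) : La m := ⟨fun i => (z.1 i : ℕ) - i, Z_sub_mono z, fun i =>
  Z_le (two_mul m) z i⟩

theorem toLa_bij (m : ℕ) : Function.Bijective (toLa m) := by
  constructor
  · intro z w h
    apply Subtype.ext
    funext i
    have h1 : (z.1 i : ℕ) - i = (w.1 i : ℕ) - i := congrFun (congrArg Subtype.val h) i
    have h2 := Z_ge z i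
    have h3 := Z_ge w i
    apply Fin.ext
    omega
  · rintro ⟨x, hx, hxn⟩
    refine ⟨⟨fun i => ⟨x i + i, by have := hxn i; have := i.2; omega⟩, ?_⟩, ?_⟩
    · intro i j hij
      have h1 := hx hij.le
      rw [Fin.lt_def] at hij ⊢
      simp only
      omega
    · apply Subtype.ext
      funext i
      simp [toLa]

open scoped Classical in
theorem card_PP (m : ℕ) :
    (Nat.card {S : Set (Fin m × Fin m × Fin m) // IsLowerSet S} : ℚ) = Hd m := by
  let e := Equiv.ofBijective _ (toLa_bij m)
  letI : Fintype (La m) := Fintype.ofEquiv _ e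
  have hfin : ∀ x : La m, Finite (GT m x.1) := fun x => (GT_card m x.1 x.2.1).1
  rw [card_lower, Nat.card_congr (Equiv.ofBijective _ (splitPP_bij m)), Nat.card_sigma,
    ← Equiv.sum_comp e]
  have hpos : 0 < ∏ i ∈ range m, (i.factorial : ℚ) := Finset.prod_pos fun i _ => by positivity
  have hne : (∏ i ∈ range m, (i.factorial : ℚ)) ^ 2 ≠ 0 := by positivity
  apply mul_left_cancel₀ hne
  rw [← B1]
  push_cast
  rw [Finset.mul_sum]
  refine Finset.sum_congr rfl fun z _ => ?_
  rw [Nat.card_prod, (GT_card m (e z).1 (e z).2.1).2]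
  have h1 := T_vand m (e z).1 (e z).2.1
  have h2 : ∀ i : Fin m, (e z).1 i + i = (z.1 i : ℕ) := by
    intro i
    have := Z_ge z i
    change (z.1 i : ℕ) - i + i = _
    omega
  simp only [h2] at h1
  rw [← h1]
  push_cast
  ring

/-! The self-complementary diagonals -/

def toLaSfun (m : ℕ) (z : Fin m → ℕ) (i : Fin (2 * m)) : ℕ :=
  if h : m ≤ (i : ℕ) then m + (z ⟨i - m, by have := i.2; omega⟩ - (i - m))
  else m - (z ⟨m - 1 - i, by omega⟩ - (m - 1 - i))

theorem toLaSfun_hi (m : ℕ) (z : Fin m → ℕ) (k : Fin m) :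
    toLaSfun m z ⟨m + k, by omega⟩ = m + (z k - k) := by
  simp [toLaSfun]

theorem toLaSfun_lo (m : ℕ) (z : Fin m → ℕ) (k : Fin m) :
    toLaSfun m z ⟨m - 1 - k, by omega⟩ = m - (z k - k) := by
  have h1 : ¬ (m ≤ m - 1 - k) := by omega
  have h2 : m - 1 - (m - 1 - k) = (k : ℕ) := by omega
  simp only [toLaSfun, h1, dite_false, h2]

theorem two_cases (m : ℕ) (i : Fin (2 * m)) :
    (∃ k : Fin m, i = ⟨m + k, by omega⟩ ∧ i.rev = ⟨m - 1 - k, by omega⟩) ∨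
    (∃ k : Fin m, i = ⟨m - 1 - k, by omega⟩ ∧ i.rev = ⟨m + k, by omega⟩) := by
  by_cases h : m ≤ (i : ℕ)
  · refine Or.inl ⟨⟨i - m, by omega⟩, ?_, ?_⟩ <;> ext <;> simp [Fin.val_rev] <;> omega
  · refine Or.inr ⟨⟨m - 1 - i, by omega⟩, ?_, ?_⟩ <;> ext <;> simp [Fin.val_rev] <;> omega

def toLaS (m : ℕ) (z : Z m (2 * m)) : LaS (2 * m) :=
  ⟨toLaSfun m (fun k => (z.1 k : ℕ)), by
    intro i j hij
    rw [Fin.le_def] at hij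
    unfold toLaSfun
    have hm := Z_sub_mono z
    split_ifs with h1 h2 h2
    · have := hm (a := ⟨i - m, by omega⟩) (b := ⟨j - m, by omega⟩) (by rw [Fin.le_def]; simp; omega)
      simp only at this ⊢
      omega
    · omega
    · omega
    · have := hm (a := ⟨m - 1 - j, by omega⟩) (b := ⟨m - 1 - i, by omega⟩)
        (by rw [Fin.le_def]; simp; omega)
      simp only at this ⊢
      omega, by
    intro i
    have key : ∀ k, (z.1 k : ℕ) - k ≤ m := Z_le (two_mul m) z
    rcases two_cases m i with ⟨k, h1, h2⟩ | ⟨k, h1, h2⟩ <;>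
    · rw [h2, h1, toLaSfun_hi, toLaSfun_lo]
      have := key k
      omega⟩

theorem toLaS_bij (m : ℕ) : Function.Bijective (toLaS m) := by
  constructor
  · intro z w h
    apply Subtype.ext
    funext k
    have h1 := congrFun (congrArg Subtype.val h) ⟨m + k, by omega⟩
    simp only [toLaS, toLaSfun_hi] at h1
    have h2 := Z_ge z k
    have h3 := Z_ge w k
    apply Fin.ext
    omega
  · rintro ⟨x, hx, hxn⟩
    have hge : ∀ k : Fin m, m ≤ x ⟨m + k, by omega⟩ ∧ x ⟨m + k, by omega⟩ ≤ 2 * m := by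
      intro k
      have h1 := hxn ⟨m + k, by omega⟩
      have h2 : x (Fin.rev ⟨m + k, by omega⟩) ≤ x ⟨m + k, by omega⟩ := by
        apply hx
        rw [Fin.le_def, Fin.val_rev]
        simp
        omega
      omega
    refine ⟨⟨fun k => ⟨x ⟨m + k, by omega⟩ - m + k, by have := hge k; omega⟩, ?_⟩, ?_⟩
    · intro i j hij
      have h1 : x ⟨m + i, by omega⟩ ≤ x ⟨m + j, by omega⟩ := hx (by
        rw [Fin.le_def]; simp; omega)
      have := hge i
      rw [Fin.lt_def] at hij ⊢
      simp only
      omega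
    · apply Subtype.ext
      funext i
      simp only [toLaS]
      rcases two_cases m i with ⟨k, h1, h2⟩ | ⟨k, h1, h2⟩
      · rw [h1, toLaSfun_hi]
        have := hge k
        omega
      · have h3 := hxn i
        rw [h2] at h3
        rw [h1, toLaSfun_lo]
        rw [h1] at h3
        have := hge k
        omega

noncomputable def epsE (m : ℕ) : Fin m ⊕ Fin m ≃ Fin (2 * m) :=
  Equiv.ofBijective (Sum.elim (fun k => ⟨m + k, by omega⟩) (fun k => ⟨m - 1 - k, by omega⟩)) (by
    rw [Fintype.bijective_iff_injective_and_card]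
    refine ⟨?_, by simp [two_mul]⟩
    rintro (a | a) (b | b) h <;> simp [Fin.ext_iff] at h ⊢ <;> omega)

noncomputable def delE (m : ℕ) : Fin m ⊕ Fin m ≃ Fin (2 * m) :=
  Equiv.ofBijective (Sum.elim (fun k => ⟨2 * k, by omega⟩) (fun k => ⟨2 * k + 1, by omega⟩)) (by
    rw [Fintype.bijective_iff_injective_and_card]
    refine ⟨?_, by simp [two_mul]⟩
    rintro (a | a) (b | b) h <;> simp [Fin.ext_iff] at h ⊢ <;> omega)

theorem vand_sym (m : ℕ) (v : Fin (2 * m) → ℚ) (w : Fin m → ℚ)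
    (h1 : ∀ k, v (epsE m (Sum.inl k)) = w k) (h2 : ∀ k, v (epsE m (Sum.inr k)) = - w k) :
    |Matrix.det (Matrix.vandermonde v)| =
      |∏ k, (2 * w k)| * Matrix.det (Matrix.vandermonde (fun k => w k ^ 2)) ^ 2 := by
  rw [← Matrix.abs_det_submatrix_equiv_equiv (epsE m) (delE m)]
  let A : Matrix (Fin m) (Fin m) ℚ := Matrix.vandermonde (fun k => w k ^ 2)
  let B : Matrix (Fin m) (Fin m) ℚ := Matrix.of fun i j => w i * A i j
  have hM : (Matrix.vandermonde v).submatrix (epsE m) (delE m) = Matrix.fromBlocks A B A (-B) := by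
    ext (i | i) (j | j)
    · simp [h1, A, Matrix.vandermonde_apply, delE, pow_mul]
    · simp [h1, A, B, Matrix.vandermonde_apply, delE, pow_mul, pow_succ, mul_comm]
      left; rw [← mul_pow]
    · simp [h2, A, Matrix.vandermonde_apply, delE, pow_mul]
    · simp [h2, A, B, Matrix.vandermonde_apply, delE, pow_mul, pow_succ, mul_comm]
      left; rw [← mul_pow, neg_mul_neg]
  have hmul : Matrix.fromBlocks (1 : Matrix (Fin m) (Fin m) ℚ) 0 (-1) 1 *
      Matrix.fromBlocks A B A (-B) = Matrix.fromBlocks A B 0 (Matrix.of fun i j => (-(2 * w i)) * A i j) := by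
    rw [Matrix.fromBlocks_multiply]
    congr 1
    · simp
    · simp
    · simp
    · ext i j
      simp [B]
      ring
  have hdet := congrArg Matrix.det hmul
  rw [Matrix.det_mul, Matrix.det_fromBlocks_zero₁₂, Matrix.det_fromBlocks_zero₂₁,
    Matrix.det_mul_column] at hdet
  simp only [Matrix.det_one, one_mul] at hdet
  rw [hM, hdet, abs_mul, abs_mul]
  have h3 : |∏ i, -(2 * w i)| = |∏ i, (2 * w i)| := by
    rw [Finset.abs_prod, Finset.abs_prod]
    simp only [abs_neg]
  rw [h3, ← sq_abs (Matrix.det (Matrix.vandermonde (fun k => w k ^ 2)))]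
  ring

theorem vand_pos (n : ℕ) (x : Fin n → ℕ) (hx : Monotone x) :
    0 ≤ Matrix.det (Matrix.vandermonde (fun i : Fin n => ((x i + i : ℕ) : ℚ))) := by
  rw [← T_vand n x hx]
  positivity

open scoped Classical in
theorem card_SC (m : ℕ) :
    (Nat.card {S : Set (Fin (2 * m) × Fin (2 * m) × Fin (2 * m)) // IsLowerSet S ∧
        ∀ i j k : Fin (2 * m), (i, j, k) ∈ S ↔ (i.rev, j.rev, k.rev) ∉ S} : ℚ) = Hd m ^ 2 := by
  let e := Equiv.ofBijective _ (toLaS_bij m)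
  letI : Fintype (LaS (2 * m)) := Fintype.ofEquiv _ e
  have hfin : ∀ x : LaS (2 * m), Finite (GT (2 * m) x.1) := fun x => (GT_card _ x.1 x.2.1).1
  rw [card_sc, Nat.card_congr (Equiv.ofBijective _ (splitS_bij (2 * m))), Nat.card_sigma,
    ← Equiv.sum_comp e]
  have hpos : 0 < ∏ i ∈ range (2 * m), (i.factorial : ℚ) := Finset.prod_pos fun i _ => by positivity
  apply mul_left_cancel₀ hpos.ne'
  have hB := B4 m
  have hprod : ∏ i ∈ range (2 * m), (i.factorial : ℚ) =
      ∏ i ∈ range m, (i.factorial : ℚ) * ((i + m).factorial : ℚ) := by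
    rw [two_mul, Finset.prod_range_add, Finset.prod_mul_distrib]
    simp only [add_comm]
  rw [hprod, ← hB, ← hprod]
  push_cast
  rw [Finset.mul_sum]
  refine Finset.sum_congr rfl fun z _ => ?_
  rw [(GT_card (2 * m) (e z).1 (e z).2.1).2, mul_comm, T_vand _ _ (e z).2.1,
    ← abs_of_nonneg (vand_pos _ _ (e z).2.1),
    ← Matrix.det_vandermonde_sub _ (2 * (m : ℚ) - 1 / 2)]
  have key : ∀ k, (z.1 k : ℕ) - k ≤ m := Z_le (two_mul m) z
  rw [vand_sym m _ (fun k => (z.1 k : ℕ) + 1 / 2)]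
  · have h1 : ∀ k : Fin m, 2 * (((z.1 k : ℕ) : ℚ) + 1 / 2) = 2 * ((z.1 k : ℕ) : ℚ) + 1 := by
      intro k; ring
    have h2 : ∀ k : Fin m, (((z.1 k : ℕ) : ℚ) + 1 / 2) ^ 2 =
      ((z.1 k : ℕ) : ℚ) * ((z.1 k : ℕ) + 1) + 1 / 4 := by
      intro k; ring
    simp only [h1, h2]
    rw [Matrix.det_vandermonde_add, abs_of_nonneg (by positivity)]
  · intro k
    have h3 : (e z).1 (epsE m (Sum.inl k)) + (epsE m (Sum.inl k) : ℕ) = 2 * m + (z.1 k : ℕ) := by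
      change toLaSfun m (fun k => (z.1 k : ℕ)) ⟨m + k, by omega⟩ + (m + k) = _
      rw [toLaSfun_hi]
      have := Z_ge z k
      omega
    rw [h3]
    push_cast
    ring
  · intro k
    have h3 : (e z).1 (epsE m (Sum.inr k)) + (epsE m (Sum.inr k) : ℕ) + (z.1 k : ℕ) + 1 = 2 * m := by
      change toLaSfun m (fun k => (z.1 k : ℕ)) ⟨m - 1 - k, by omega⟩ + (m - 1 - k) + _ + 1 = _
      rw [toLaSfun_lo]
      have := Z_ge z k
      have := key k
      omega
    have h4 : (((e z).1 (epsE m (Sum.inr k)) + (epsE m (Sum.inr k) : ℕ) : ℕ) : ℚ) +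
        ((z.1 k : ℕ) : ℚ) + 1 = 2 * m := by exact_mod_cast h3
    linear_combination h4


end SCPP

/-- (Stanley) For every `m ≥ 0`, the number of self-complementary plane partitions in the
`2m`-cube (lower sets `S` of `Fin (2m) × Fin (2m) × Fin (2m)` with
`(i,j,k) ∈ S ↔ (2m-1-i, 2m-1-j, 2m-1-k) ∉ S`, where `Fin.rev i = 2m-1-i`) equals the square of
the number of plane partitions in the `m`-cube; explicitly it equals
`∏_{i=0}^{m-1} (i!)²·((i+2m)!)²/((i+m)!)⁴`. -/
theorem card_selfComplementary_planePartitions (m : ℕ) :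
    Nat.card {S : Set (Fin (2 * m) × Fin (2 * m) × Fin (2 * m)) // IsLowerSet S ∧
        ∀ i j k : Fin (2 * m), (i, j, k) ∈ S ↔ (i.rev, j.rev, k.rev) ∉ S} =
      (Nat.card {S : Set (Fin m × Fin m × Fin m) // IsLowerSet S}) ^ 2 ∧
    (Nat.card {S : Set (Fin (2 * m) × Fin (2 * m) × Fin (2 * m)) // IsLowerSet S ∧
        ∀ i j k : Fin (2 * m), (i, j, k) ∈ S ↔ (i.rev, j.rev, k.rev) ∉ S} : ℚ) =
      ∏ i ∈ Finset.range m,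
        ((Nat.factorial i : ℚ) ^ 2 * (Nat.factorial (i + 2 * m) : ℚ) ^ 2) /
          (Nat.factorial (i + m) : ℚ) ^ 4 := by
  have h1 := SCPP.card_SC m
  have h2 := SCPP.card_PP m
  refine ⟨?_, ?_⟩
  · rw [← h2] at h1
    exact_mod_cast h1
  · rw [h1, SCPP.Hd_eq, ← Finset.prod_pow]
    refine Finset.prod_congr rfl fun i _ => ?_
    rw [div_pow, mul_pow, ← pow_mul]
end

section
/- (Kuperberg) For every m ≥ 0, the number of cyclically symmetric self-complementary plane partitions in the 2m-cube, i.e. of lower sets S of Fin (2m) × Fin (2m) × Fin (2m) under the componentwise order satisfying both (i,j,k) ∈ S ↔ (j,k,i) ∈ S and (i,j,k) ∈ S ↔ (2m-1-i, 2m-1-j, 2m-1-k) ∉ S, equals ∏_{i=0}^{m-1} ((3i+1)!)² / ((i+m)!)². -/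
namespace CSSC
open Matrix Finset


section Desnanot
variable {R : Type*} [CommRing R]

/-- Jacobi identity for a 2 x 2 block of the adjugate, up to the factor `det`. -/
theorem jacobi_aux {p q : Type*} [Fintype p] [Fintype q] [DecidableEq p] [DecidableEq q]
    (K : Matrix (p ⊕ q) (p ⊕ q) R) :
    K.det * (K.adjugate.toBlocks₁₁).det = K.det * (K.det ^ (Fintype.card p - 1) * 
      (if Fintype.card p = 0 then 0 else 1) * K.toBlocks₂₂.det) ∨ Fintype.card p = 0 := by
  by_cases h0 : Fintype.card p = 0
  · right; exact h0
  left
  have h : K * fromBlocks K.adjugate.toBlocks₁₁ 0 K.adjugate.toBlocks₂₁ 1 =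
      fromBlocks (K.det • 1) K.toBlocks₁₂ 0 K.toBlocks₂₂ := by
    have h1 := K.mul_adjugate
    rw [← fromBlocks_toBlocks K] at h1 ⊢
    rw [← fromBlocks_toBlocks (fromBlocks K.toBlocks₁₁ K.toBlocks₁₂ K.toBlocks₂₁
      K.toBlocks₂₂).adjugate, fromBlocks_multiply, ← fromBlocks_one, fromBlocks_smul] at h1
    rw [fromBlocks_multiply]
    have := fromBlocks_inj.1 h1
    simp only [fromBlocks_toBlocks] at this ⊢
    rw [fromBlocks_inj]
    refine ⟨this.1, by simp, by simpa using this.2.2.1, by simp⟩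
  have h2 := congrArg det h
  rw [det_mul, det_fromBlocks_zero₁₂, det_fromBlocks_zero₂₁, det_one, mul_one, det_smul, det_one,
    mul_one] at h2
  rw [h2, if_neg h0]
  obtain ⟨c, hc⟩ := Nat.exists_eq_succ_of_ne_zero h0
  rw [hc, Nat.succ_sub_one, pow_succ]; ring

theorem jacobi_two {q : Type*} [Fintype q] [DecidableEq q]
    (K : Matrix (Fin 2 ⊕ q) (Fin 2 ⊕ q) R) :
    (K.adjugate.toBlocks₁₁).det = K.det * K.toBlocks₂₂.det := by
  let K' := mvPolynomialX (Fin 2 ⊕ q) (Fin 2 ⊕ q) ℤ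
  suffices hK : (K'.adjugate.toBlocks₁₁).det = K'.det * K'.toBlocks₂₂.det by
    let φ := MvPolynomial.eval₂Hom (Int.castRingHom R) (fun p : (Fin 2 ⊕ q) × (Fin 2 ⊕ q) => K p.1 p.2)
    have hφ : φ.mapMatrix K' = K := by
      ext i j; simp [φ, K', mvPolynomialX]
    have h := congrArg φ hK
    rw [map_mul, RingHom.map_det, RingHom.map_det, RingHom.map_det, hφ] at h
    have e1 : φ.mapMatrix K'.adjugate.toBlocks₁₁ = K.adjugate.toBlocks₁₁ := by
      rw [← hφ, ← RingHom.map_adjugate]; rfl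
    have e2 : φ.mapMatrix K'.toBlocks₂₂ = K.toBlocks₂₂ := by
      rw [← hφ]; rfl
    rwa [e1, e2] at h
  rcases jacobi_aux K' with h | h
  · have := mul_left_cancel₀ (det_mvPolynomialX_ne_zero _ ℤ) h
    simpa using this
  · simp at h

/-- the equivalence putting first and last index in front -/
def ends (n : ℕ) : Fin 2 ⊕ Fin n ≃ Fin (n + 2) where
  toFun := Sum.elim (fun i => if i = 0 then 0 else Fin.last (n + 1)) (fun i => i.castSucc.succ)
  invFun i := if h0 : i.val = 0 then Sum.inl 0 else
    if h1 : i.val = n + 1 then Sum.inl 1 else Sum.inr ⟨i.val - 1, by omega⟩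
  left_inv := by
    rintro (i | i)
    · fin_cases i <;> simp
    · have := i.2
      simp
      omega
  right_inv := by
    intro i
    have := i.2
    by_cases h0 : i.val = 0
    · beta_reduce; rw [dif_pos h0]; exact Fin.ext h0.symm
    · by_cases h1 : i.val = n + 1
      · beta_reduce; rw [dif_neg h0, dif_pos h1]; exact Fin.ext h1.symm
      · simp only [h0, h1, dite_false, Sum.elim_inr]
        simp [Fin.ext_iff]; omega

theorem desnanot_jacobi (n : ℕ) (K : Matrix (Fin (n + 2)) (Fin (n + 2)) R) :
    K.det * (K.submatrix (fun i : Fin n => i.castSucc.succ) (fun i : Fin n => i.castSucc.succ)).det =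
      (K.submatrix Fin.castSucc Fin.castSucc).det * (K.submatrix Fin.succ Fin.succ).det -
      (K.submatrix Fin.succ Fin.castSucc).det * (K.submatrix Fin.castSucc Fin.succ).det := by
  have h := jacobi_two (K.submatrix (ends n) (ends n))
  rw [adjugate_submatrix_equiv_self, det_submatrix_equiv_self, det_fin_two] at h
  have e : (K.submatrix (ends n) (ends n)).toBlocks₂₂ = 
    K.submatrix (fun i : Fin n => i.castSucc.succ) (fun i : Fin n => i.castSucc.succ) := by
    ext i j; rfl
  rw [e] at h
  rw [← h]
  simp only [toBlocks₁₁, of_apply, submatrix_apply, ends, Equiv.coe_fn_mk, Sum.elim_inl, if_true,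
    one_ne_zero, if_false, adjugate_fin_succ_eq_det_submatrix, Fin.succAbove_zero, Fin.succAbove_last]
  simp only [Fin.val_zero, Fin.val_last, add_zero, zero_add, pow_zero, one_mul]
  rw [← mul_pow_sub_one (n := n+1+(n+1)) (by omega)]
  have : ((-1 : R) ^ (n+1)) * (-1) ^ (n+1) = 1 := by rw [← mul_pow]; simp
  have h2 : (-1 : R) * (-1) ^ (n+1+(n+1)-1) = 1 := by
    rw [mul_pow_sub_one (by omega), pow_add, this]
  rw [h2]
  linear_combination (-(K.submatrix Fin.succ Fin.castSucc).det * (K.submatrix Fin.castSucc Fin.succ).det) * this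
end Desnanot

section Kratt

/-- rising factorial -/
def asc {R : Type*} [CommRing R] (z : R) (k : ℕ) : R := ∏ l ∈ range k, (z + l)
/-- falling factorial -/
def dsc {R : Type*} [CommRing R] (z : R) (k : ℕ) : R := ∏ l ∈ range k, (z - l)

variable {R : Type*} [CommRing R]

theorem asc_succ (z : R) (k : ℕ) : asc z (k + 1) = asc z k * (z + k) := prod_range_succ _ _
theorem asc_succ' (z : R) (k : ℕ) : asc z (k + 1) = z * asc (z + 1) k := by
  rw [asc, prod_range_succ', asc, mul_comm]
  congr 1
  · simp
  · exact prod_congr rfl fun i _ => by push_cast; ring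
theorem dsc_succ' (z : R) (k : ℕ) : dsc z (k + 1) = z * dsc (z - 1) k := by
  rw [dsc, prod_range_succ', dsc, mul_comm]
  congr 1
  · simp
  · exact prod_congr rfl fun i _ => by push_cast; ring

/-- Krattenthaler matrix, with polynomial entries. -/
def kmat (n : ℕ) (x y : R) : Matrix (Fin n) (Fin n) R := fun i j =>
  asc (x + y) (i + j) * dsc (x + 2 * (i : ℕ)) j * dsc (y + 2 * (j : ℕ)) i

def alp (n : ℕ) (z : R) : R := ∏ i ∈ range n, asc (z + 2 * i) i
def bet (n : ℕ) (s : R) : R := ∏ i ∈ range n, asc s i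
def fct (n : ℕ) : R := ∏ i ∈ range n, (Nat.factorial i : R)

def kval (n : ℕ) (x y : R) : R :=
  fct n * bet n (x + y) * alp n (2 * x + y) * alp n (x + 2 * y)

theorem det_mul_row_col {n : ℕ} (c : R) (f g : Fin n → R) (A : Matrix (Fin n) (Fin n) R) :
    det (fun i j => c * f i * g j * A i j) = c ^ n * (∏ i, f i) * (∏ i, g i) * det A := by
  have : (fun i j => c * f i * g j * A i j) = c • (diagonal f * A * diagonal g) := by
    ext i j
    simp [mul_assoc]
    ring
  rw [this, det_smul, det_mul, det_mul, det_diagonal, det_diagonal, Fintype.card_fin]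
  ring

theorem kmat_ss (n : ℕ) (x y : R) :
    ((kmat (n + 1) x y).submatrix Fin.succ Fin.succ).det =
      ((x + y) * (x + y + 1)) ^ n * (∏ i ∈ range n, (x + 2 * i + 2)) *
        (∏ i ∈ range n, (y + 2 * i + 2)) * (kmat n (x + 1) (y + 1)).det := by
  rw [← Fin.prod_univ_eq_prod_range (fun i => x + 2 * (i : R) + 2),
    ← Fin.prod_univ_eq_prod_range (fun i => y + 2 * (i : R) + 2), ← det_mul_row_col]
  congr 1
  ext i j
  simp only [submatrix_apply, kmat, Fin.val_succ]
  rw [show (i : ℕ) + 1 + (j + 1) = i + j + 1 + 1 by ring, asc_succ', asc_succ', dsc_succ', dsc_succ']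
  push_cast
  rw [show x + y + 1 + 1 = x + 1 + (y + 1) by ring,
    show x + 2 * ((i : ℕ) + 1 : R) - 1 = x + 1 + 2 * (i : ℕ) by ring,
    show y + 2 * ((j : ℕ) + 1 : R) - 1 = y + 1 + 2 * (j : ℕ) by ring]
  ring

theorem kmat_sc (n : ℕ) (x y : R) :
    ((kmat (n + 1) x y).submatrix Fin.succ Fin.castSucc).det =
      (x + y) ^ n * (∏ i ∈ range n, (y + 2 * i)) * (kmat n (x + 2) (y - 1)).det := by
  rw [← Fin.prod_univ_eq_prod_range (fun i => y + 2 * (i : R))]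
  have := det_mul_row_col (x + y) (fun _ => 1) (fun i : Fin n => y + 2 * ((i : ℕ) : R)) 
    (kmat n (x + 2) (y - 1))
  rw [prod_const_one, mul_one ((x + y) ^ n)] at this
  rw [← this]
  congr 1
  ext i j
  simp only [submatrix_apply, kmat, Fin.val_succ, Fin.val_castSucc]
  rw [show (i : ℕ) + 1 + (j) = i + j + 1 by ring, asc_succ', dsc_succ']
  push_cast
  rw [show x + 2 + (y - 1) = x + y + 1 by ring,
    show x + 2 * ((i : ℕ) + 1 : R) = x + 2 + 2 * (i : ℕ) by ring,
    show y - 1 + 2 * (j : ℕ) = y + 2 * (j : ℕ) - 1 by ring]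
  ring

theorem kmat_cs (n : ℕ) (x y : R) :
    ((kmat (n + 1) x y).submatrix Fin.castSucc Fin.succ).det =
      (x + y) ^ n * (∏ i ∈ range n, (x + 2 * i)) * (kmat n (x - 1) (y + 2)).det := by
  rw [← Fin.prod_univ_eq_prod_range (fun i => x + 2 * (i : R))]
  have := det_mul_row_col (x + y) (fun i : Fin n => x + 2 * ((i : ℕ) : R)) (fun _ => 1) 
    (kmat n (x - 1) (y + 2))
  rw [prod_const_one, mul_one] at this
  rw [← this]
  congr 1
  ext i j
  simp only [submatrix_apply, kmat, Fin.val_succ, Fin.val_castSucc]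
  rw [show (i : ℕ) + (j + 1) = i + j + 1 by ring, asc_succ', dsc_succ']
  push_cast
  rw [show x - 1 + (y + 2) = x + y + 1 by ring,
    show y + 2 * ((j : ℕ) + 1 : R) = y + 2 + 2 * (j : ℕ) by ring,
    show x - 1 + 2 * (i : ℕ) = x + 2 * (i : ℕ) - 1 by ring]
  ring

theorem kmat_cc (n : ℕ) (x y : R) :
    ((kmat (n + 1) x y).submatrix Fin.castSucc Fin.castSucc) = kmat n x y := rfl

theorem kmat_mid (n : ℕ) (x y : R) :
    ((kmat (n + 2) x y).submatrix (fun i : Fin n => i.castSucc.succ)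
      (fun i : Fin n => i.castSucc.succ)).det =
      ((x + y) * (x + y + 1)) ^ n * (∏ i ∈ range n, (x + 2 * i + 2)) *
        (∏ i ∈ range n, (y + 2 * i + 2)) * (kmat n (x + 1) (y + 1)).det := by
  rw [← kmat_ss]; rfl

theorem alp_rel (n : ℕ) (z : R) :
    alp (n + 2) z * alp n (z + 3) = (z + 2 * (n + 1)) * (alp (n + 1) z * alp (n + 1) (z + 3)) := by
  have h1 : alp (n + 2) z = alp (n + 1) z * asc (z + 2 * (n + 1)) (n + 1) := by
    rw [alp, prod_range_succ, alp]; push_cast; rfl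
  have h2 : alp (n + 1) (z + 3) = alp n (z + 3) * asc (z + 3 + 2 * n) n := by
    rw [alp, prod_range_succ, alp]
  rw [h1, h2, asc_succ', show z + 2 * (n + 1 : R) + 1 = z + 3 + 2 * n by ring]
  ring

theorem bet_succ (n : ℕ) (s : R) : bet (n + 1) s = bet n s * asc s n := prod_range_succ _ _

theorem bet_rel1 (n : ℕ) (s : R) :
    s * (bet (n + 1) s * bet (n + 1) (s + 2) * (s * (s + 1)) ^ (n + 1)) =
      (s + n + 1) * (bet (n + 1) (s + 1) ^ 2 * (s ^ (n + 1)) ^ 2) := by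
  induction n with
  | zero => simp [bet, asc]; ring
  | succ n ih =>
    rw [bet_succ (n + 1), bet_succ (n + 1), bet_succ (n + 1)]
    have h1 := asc_succ' s (n + 1)
    have h2 := asc_succ s (n + 1)
    have h3 := asc_succ' s n
    have h4 := asc_succ' (s + 1) n
    have h5 := asc_succ (s + 1) n
    have h6 := asc_succ' (s + 1) (n + 1)
    have h7 := asc_succ (s + 1) (n + 1)
    rw [show s + 1 + 1 = s + 2 by ring] at h4 h6
    push_cast at *
    have h8 : (s + 1) * asc (s + 2) (n + 1) = asc (s + 1) (n + 1) * (s + n + 2) := by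
      rw [← h6, h7]; ring
    have h9 : asc (s + 1) (n + 1) = asc (s + 1) n * (s + n + 1) := by rw [h5]; ring
    calc _ = (s * (bet (n + 1) s * bet (n + 1) (s + 2) * (s * (s + 1)) ^ (n + 1))) *
          (asc s (n + 1) * s * ((s + 1) * asc (s + 2) (n + 1))) := by ring
      _ = (bet (n + 1) (s + 1) ^ 2 * (s ^ (n + 1)) ^ 2) * s^2 *
           ((asc (s + 1) n * (s + n + 1)) * asc (s + 1) (n + 1)) * (s + n + 2) := by
          rw [ih, h8, h3]; ring
      _ = _ := by rw [← h9]; ring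

theorem bet_rel2 (n : ℕ) (s : R) :
    (s + n + 1) * (bet (n + 2) s * bet n (s + 2)) =
      s * (s + 1) * (bet (n + 1) s * bet (n + 1) (s + 2)) := by
  rw [bet_succ (n + 1), bet_succ n (s + 2)]
  have h1 := asc_succ' s (n + 1)
  have h2 := asc_succ s (n + 1)
  have h4 := asc_succ' (s + 1) n
  rw [show s + 1 + 1 = s + 2 by ring] at h4
  push_cast at *
  rw [h1, h4] at h2
  linear_combination (-bet (n + 1) s * bet n (s + 2)) * h2

theorem fct_rel (n : ℕ) : (fct (n + 2) * fct n : R) = (n + 1) * fct (n + 1) ^ 2 := by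
  rw [fct, prod_range_succ, ← fct, fct, prod_range_succ, ← fct, Nat.factorial_succ]
  push_cast; ring

theorem kval_rel (n : ℕ) (x y : R) :
    (x + y) ^ 2 * (kval (n + 2) x y * (((x + y) * (x + y + 1)) ^ n * (∏ i ∈ range n, (x + 2 * i + 2)) *
        (∏ i ∈ range n, (y + 2 * i + 2)) * kval n (x + 1) (y + 1))) * (x + y + n + 1) =
     (x + y) ^ 2 * (kval (n + 1) x y *  (((x + y) * (x + y + 1)) ^ (n + 1) * (∏ i ∈ range (n + 1), (x + 2 * i + 2)) *
        (∏ i ∈ range (n + 1), (y + 2 * i + 2)) * kval (n + 1) (x + 1) (y + 1)) -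
      ((x + y) ^ (n + 1) * (∏ i ∈ range (n + 1), (y + 2 * i)) * kval (n + 1) (x + 2) (y - 1)) *
      ((x + y) ^ (n + 1) * (∏ i ∈ range (n + 1), (x + 2 * i)) * kval (n + 1) (x - 1) (y + 2))) * (x + y + n + 1) := by
  simp only [kval]
  rw [show x + 1 + (y + 1) = x + y + 2 by ring, show 2 * (x + 1) + (y + 1) = 2 * x + y + 3 by ring,
    show x + 1 + 2 * (y + 1) = x + 2 * y + 3 by ring, show x + 2 + (y - 1) = x + y + 1 by ring,
    show x - 1 + (y + 2) = x + y + 1 by ring, show 2 * (x + 2) + (y - 1) = 2 * x + y + 3 by ring,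
    show x + 2 + 2 * (y - 1) = x + 2 * y by ring, show 2 * (x - 1) + (y + 2) = 2 * x + y by ring,
    show x - 1 + 2 * (y + 2) = x + 2 * y + 3 by ring]
  have hx : ∏ i ∈ range (n + 1), (x + 2 * (i : R)) = x * ∏ i ∈ range n, (x + 2 * (i : R) + 2) := by
    rw [prod_range_succ', mul_comm]
    congr 1
    · simp
    · exact prod_congr rfl fun i _ => by push_cast; ring
  have hy : ∏ i ∈ range (n + 1), (y + 2 * (i : R)) = y * ∏ i ∈ range n, (y + 2 * (i : R) + 2) := by
    rw [prod_range_succ', mul_comm]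
    congr 1
    · simp
    · exact prod_congr rfl fun i _ => by push_cast; ring
  rw [hx, hy, prod_range_succ (fun i : ℕ => x + 2 * (i : R) + 2),
    prod_range_succ (fun i : ℕ => y + 2 * (i : R) + 2)]
  have a1 := alp_rel n (2 * x + y)
  have a2 := alp_rel n (x + 2 * y)
  have b1 := bet_rel1 n (x + y)
  have b2 := bet_rel2 n (x + y)
  have f1 := fct_rel (R := R) n
  generalize (∏ i ∈ range n, (x + 2 * (i : R) + 2)) = px
  generalize (∏ i ∈ range n, (y + 2 * (i : R) + 2)) = py
  generalize alp (n + 2) (2 * x + y) = a at *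
  generalize alp n (2 * x + y + 3) = a' at *
  generalize alp (n + 1) (2 * x + y) = b at *
  generalize alp (n + 1) (2 * x + y + 3) = b' at *
  generalize alp (n + 2) (x + 2 * y) = c at *
  generalize alp n (x + 2 * y + 3) = c' at *
  generalize alp (n + 1) (x + 2 * y) = d at *
  generalize alp (n + 1) (x + 2 * y + 3) = d' at *
  generalize bet (n + 2) (x + y) = e0 at *
  generalize bet n (x + y + 2) = e1 at *
  generalize bet (n + 1) (x + y) = e2 at *
  generalize bet (n + 1) (x + y + 2) = e3 at *
  generalize bet (n + 1) (x + y + 1) = e4 at *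
  generalize (fct (n + 2) : R) = f0 at *
  generalize (fct n : R) = f2 at *
  generalize (fct (n + 1) : R) = f3 at *
  calc _ = (x + y) ^ 2 * (f0 * f2) * (a * a') * (c * c') * ((x + y + n + 1) * (e0 * e1)) *
      (((x + y) * (x + y + 1)) ^ n) * px * py := by ring
    _ = (x + y) * ((n + 1) * f3 ^ 2) * ((2 * x + y + 2 * (n + 1)) * (b * b')) *
        ((x + 2 * y + 2 * (n + 1)) * (d * d')) *
        ((x + y) * (e2 * e3 * ((x + y) * (x + y + 1)) ^ (n + 1))) * px * py := by
        rw [a1, a2, b2, f1]; ring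
    _ = (x + y) * ((x + y) * (e2 * e3 * ((x + y) * (x + y + 1)) ^ (n + 1))) * f3 ^ 2 * b * b' * d * d' *
          px * py * ((x + 2 * n + 2) * (y + 2 * n + 2)) * (x + y + n + 1) -
        (x + y) * ((x + y) * ((x + y + n + 1) * (e4 ^ 2 * ((x + y) ^ (n + 1)) ^ 2))) * f3 ^ 2 * b * b' * d * d' *
          px * py * (x * y) := by
        rw [← b1]; ring
    _ = _ := by ring

open Polynomial in
theorem kmat_det_poly (n : ℕ) (a b : ℚ) :
    (kmat n (X + C a) (X + C b) : Matrix (Fin n) (Fin n) ℚ[X]).det =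
      kval n (X + C a) (X + C b) := by
  induction n using Nat.strong_induction_on generalizing a b with
  | _ n ih =>
  rcases n with _ | _ | n
  · simp [kval, fct, bet, alp]
  · simp [kval, fct, bet, alp, kmat, asc, dsc]
  · have lin : ∀ (p : ℕ) (q : ℚ), p ≠ 0 → (p : ℚ[X]) * X + C q ≠ 0 := by
      intro p q hp h
      have := congrArg (fun f => coeff f 1) h
      simp at this
      exact hp this
    have ascne : ∀ (p : ℕ) (q : ℚ) (k : ℕ), p ≠ 0 → asc ((p : ℚ[X]) * X + C q) k ≠ 0 := by
      intro p q k hp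
      rw [asc, prod_ne_zero_iff]
      intro l _
      have := lin p (q + l) hp
      rwa [C_add, ← add_assoc, C_eq_natCast] at this
    have D := desnanot_jacobi n (kmat (n + 2) (X + C a : ℚ[X]) (X + C b))
    rw [kmat_mid, kmat_ss, kmat_sc, kmat_cs, kmat_cc] at D
    have i0 := ih n (by omega) (a + 1) (b + 1)
    have i1 := ih (n + 1) (by omega) (a + 1) (b + 1)
    have i2 := ih (n + 1) (by omega) a b
    have i3 := ih (n + 1) (by omega) (a + 2) (b - 1)
    have i4 := ih (n + 1) (by omega) (a - 1) (b + 2)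
    have ea : (X + C (a + 1) : ℚ[X]) = X + C a + 1 := by simp [add_assoc]
    have eb : (X + C (b + 1) : ℚ[X]) = X + C b + 1 := by simp [add_assoc]
    have ea2 : (X + C (a + 2) : ℚ[X]) = X + C a + 2 := by rw [C_add, add_assoc]; rfl
    have eb2 : (X + C (b + 2) : ℚ[X]) = X + C b + 2 := by rw [C_add, add_assoc]; rfl
    have ea1 : (X + C (a - 1) : ℚ[X]) = X + C a - 1 := by simp [add_sub_assoc]
    have eb1 : (X + C (b - 1) : ℚ[X]) = X + C b - 1 := by simp [add_sub_assoc]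
    rw [ea, eb] at i0 i1
    rw [ea2, eb1] at i3
    rw [ea1, eb2] at i4
    rw [i0, i1, i2, i3, i4] at D
    have V := kval_rel n (X + C a : ℚ[X]) (X + C b)
    rw [← D] at V
    have hs : (X + C a + (X + C b) : ℚ[X]) = ((2 : ℕ) : ℚ[X]) * X + C (a + b) := by
      rw [C_add]; push_cast; ring
    have hs0 : (X + C a + (X + C b) : ℚ[X]) ≠ 0 := by rw [hs]; exact lin _ _ (by norm_num)
    have hs1 : (X + C a + (X + C b) + (n : ℚ[X]) + 1 : ℚ[X]) ≠ 0 := by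
      have := lin 2 (a + b + n + 1) (by norm_num)
      rw [C_add, C_add (b := (n : ℚ)), ← add_assoc, ← add_assoc, ← hs] at this
      simpa using this
    have hs2 : (X + C a + (X + C b) + 1 : ℚ[X]) ≠ 0 := by
      have := lin 2 (a + b + 1) (by norm_num)
      rw [C_add, ← add_assoc, ← hs] at this
      simpa using this
    have V1 := mul_left_cancel₀ (pow_ne_zero 2 hs0) (mul_right_cancel₀ hs1 V)
    refine (mul_right_cancel₀ ?_ V1).symm
    have l1 : ∀ c : ℚ, ∏ i ∈ range n, (X + C c + 2 * (i : ℚ[X]) + 2) ≠ 0 := by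
      intro c
      rw [prod_ne_zero_iff]
      intro i _
      have := lin 1 (c + 2 * i + 2) (by norm_num)
      rw [C_add, C_add, C_mul] at this
      simp only [Nat.cast_one, one_mul, C_eq_natCast] at this
      rwa [← add_assoc, ← add_assoc] at this
    refine mul_ne_zero (mul_ne_zero (mul_ne_zero (pow_ne_zero _ (mul_ne_zero hs0 hs2)) (l1 a)) (l1 b)) ?_
    rw [kval]
    refine mul_ne_zero (mul_ne_zero (mul_ne_zero ?_ ?_) ?_) ?_
    · rw [fct, prod_ne_zero_iff]
      intro i _
      exact_mod_cast Nat.factorial_ne_zero i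
    · rw [bet, prod_ne_zero_iff]
      intro i _
      have := ascne 2 (a + b + 2) i (by norm_num)
      rw [C_add (b := (2 : ℚ)), ← add_assoc, ← hs] at this
      convert this using 2
      rw [show (C 2 : ℚ[X]) = 2 from rfl]; ring
    · rw [alp, prod_ne_zero_iff]
      intro i _
      have := ascne 3 (2 * a + b + 3 + 2 * i) i (by norm_num)
      convert this using 2
      simp only [C_add, C_mul, C_eq_natCast]
      rw [show (C 2 : ℚ[X]) = 2 from rfl, show (C 3 : ℚ[X]) = 3 from rfl]; push_cast; ring
    · rw [alp, prod_ne_zero_iff]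
      intro i _
      have := ascne 3 (a + 2 * b + 3 + 2 * i) i (by norm_num)
      convert this using 2
      simp only [C_add, C_mul, C_eq_natCast]
      rw [show (C 2 : ℚ[X]) = 2 from rfl, show (C 3 : ℚ[X]) = 3 from rfl]; push_cast; ring

open Polynomial in
theorem kmat_det (n : ℕ) (a b : ℚ) : (kmat n a b).det = kval n a b := by
  have h := congrArg (evalRingHom (0 : ℚ)) (kmat_det_poly n a b)
  rw [RingHom.map_det] at h
  convert h using 1
  · congr 1
    ext i j
    simp [kmat, asc, dsc, eval_prod]
  · simp [kval, fct, bet, alp, asc, eval_prod]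
end Kratt

section Em

/-- increasing enumeration of a finite set of naturals with `k` elements -/
noncomputable def em (C : Finset ℕ) (k : ℕ) (i : Fin k) : ℕ :=
  if h : C.card = k then C.orderEmbOfFin h i else 0

theorem em_strictMono {C : Finset ℕ} {k : ℕ} (h : C.card = k) : StrictMono (em C k) := by
  intro i j hij
  simp only [em, dif_pos h]
  exact (C.orderEmbOfFin h).strictMono hij

theorem em_mem {C : Finset ℕ} {k : ℕ} (h : C.card = k) (i : Fin k) : em C k i ∈ C := by
  simp only [em, dif_pos h]
  exact C.orderEmbOfFin_mem h i

theorem em_image {C : Finset ℕ} {k : ℕ} (h : C.card = k) : univ.image (em C k) = C := by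
  have : em C k = C.orderEmbOfFin h := by ext i; simp [em, dif_pos h]
  rw [this]; exact C.image_orderEmbOfFin_univ h

theorem em_exists {C : Finset ℕ} {k : ℕ} (h : C.card = k) {c : ℕ} (hc : c ∈ C) :
    ∃ i, em C k i = c := by
  rw [← em_image h] at hc
  simpa using hc

theorem em_unique {k : ℕ} {f : Fin k → ℕ} (hf : StrictMono f) : em (univ.image f) k = f := by
  have h : (univ.image f).card = k := by
    rw [card_image_of_injective _ hf.injective]; simp
  have := Finset.orderEmbOfFin_unique (s := univ.image f) h (f := f) (fun i => by simp) hf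
  ext i
  simp only [em, dif_pos h]
  rw [← this]

theorem card_filter_em {C : Finset ℕ} {k : ℕ} (h : C.card = k) (p : ℕ → Prop) [DecidablePred p] :
    (C.filter p).card = (univ.filter (fun i => p (em C k i))).card := by
  conv_lhs => rw [← em_image h]
  rw [filter_image, card_image_of_injective _ (em_strictMono h).injective]

end Em

section CauchyBinet
variable {R : Type*} [CommRing R]

/-- maximal minor with row set `C` -/
noncomputable def mnr {m : ℕ} (X : ℕ → Fin m → R) (C : Finset ℕ) : R :=
  det (of fun i j : Fin m => X (em C m i) j)

theorem cauchy_binet {n m : ℕ} (X Y : ℕ → Fin m → R) :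
    det (of fun i j : Fin m => ∑ b ∈ range n, X b i * Y b j) =
      ∑ C ∈ powersetCard m (range n), mnr X C * mnr Y C := by
  classical
  have h1 : det (of fun i j : Fin m => ∑ b ∈ range n, X b i * Y b j) =
      ∑ r ∈ Fintype.piFinset (fun _ : Fin m => range n),
        (∏ j, Y (r j) j) * det (of fun j i : Fin m => X (r j) i) := by
    rw [← det_transpose]
    have : (of fun i j : Fin m => ∑ b ∈ range n, X b i * Y b j)ᵀ =
        of fun j : Fin m => ∑ b ∈ range n, Y b j • X b := by
      ext j i
      simp [mul_comm]
    rw [this]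
    have h := MultilinearMap.map_sum_finset (detRowAlternating (n := Fin m) (R := R)).toMultilinearMap
      (fun (j : Fin m) (b : ℕ) => Y b j • X b) (fun _ => range n)
    refine h.trans (sum_congr rfl fun r _ => ?_)
    exact MultilinearMap.map_smul_univ _ _ _
  rw [h1, ← sum_filter_add_sum_filter_not _ (fun r : Fin m → ℕ => Function.Injective r)]
  have h2 : ∑ r ∈ (Fintype.piFinset (fun _ : Fin m => range n)).filter
      (fun r : Fin m → ℕ => ¬ Function.Injective r),
        (∏ j, Y (r j) j) * det (of fun j i : Fin m => X (r j) i) = 0 := by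
    refine sum_eq_zero fun r hr => ?_
    rw [mem_filter] at hr
    have := hr.2
    simp only [Function.Injective, not_forall] at this
    obtain ⟨a, b, hab, hne⟩ := this
    rw [det_zero_of_row_eq hne (by ext; simp [hab]), mul_zero]
  rw [h2, add_zero, ← sum_fiberwise_of_maps_to (g := fun r : Fin m → ℕ => univ.image r)
    (t := powersetCard m (range n))]
  · refine sum_congr rfl fun C hC => ?_
    rw [mem_powersetCard] at hC
    have hm := hC.2
    have hY : mnr Y C = ∑ τ : Equiv.Perm (Fin m), ((Equiv.Perm.sign τ : ℤ) : R) * ∏ j, Y (em C m (τ j)) j := by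
      rw [mnr, det_apply']; rfl
    rw [hY, mul_sum]
    symm
    refine sum_bij (fun τ _ => em C m ∘ τ) ?_ ?_ ?_ ?_
    · intro τ _
      simp only [mem_filter, Fintype.mem_piFinset, Function.comp]
      refine ⟨⟨fun i => hC.1 (em_mem hm _), (em_strictMono hm).injective.comp τ.injective⟩, ?_⟩
      have := em_image hm
      conv_rhs => rw [← this]
      ext c
      simp only [mem_image, mem_univ, true_and]
      exact ⟨fun ⟨a, ha⟩ => ⟨_, ha⟩, fun ⟨a, ha⟩ => ⟨τ.symm a, by simpa using ha⟩⟩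
    · intro τ _ τ' _ h
      ext i
      have := congrFun h i
      exact congrArg Fin.val ((em_strictMono hm).injective this)
    · intro r hr
      simp only [mem_filter, Fintype.mem_piFinset] at hr
      have : ∀ j, ∃ i, em C m i = r j := fun j => em_exists hm (by rw [← hr.2]; simp)
      choose τ hτ using this
      have hinj : Function.Injective τ := fun a b hab => hr.1.2 (by rw [← hτ, ← hτ, hab])
      refine ⟨Equiv.ofBijective τ (Finite.injective_iff_bijective.1 hinj), mem_univ _, ?_⟩
      ext j; exact hτ j
    · intro τ _
      have := det_permute τ (of fun i j : Fin m => X (em C m i) j)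
      have e : (submatrix (of fun i j : Fin m => X (em C m i) j) τ id : Matrix (Fin m) (Fin m) R) =
        of fun j i => X ((em C m ∘ τ) j) i := by ext; rfl
      rw [e] at this
      rw [this, mnr]
      simp only [Function.comp]
      ring
  · intro r hr
    simp only [mem_filter, Fintype.mem_piFinset] at hr
    rw [mem_powersetCard]
    refine ⟨?_, by rw [card_image_of_injective _ hr.2]; simp⟩
    intro c hc
    simp only [mem_image, mem_univ, true_and] at hc
    obtain ⟨j, rfl⟩ := hc
    exact hr.1 j
end CauchyBinet

section Chains

/-- number of elements `≥ s` -/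
def cge (C : Finset ℕ) (s : ℕ) : ℕ := (C.filter (fun c => s ≤ c)).card

def nxt (C C' : Finset ℕ) : Prop := ∀ s, cge C (s + 1) ≤ cge C' s ∧ cge C' s ≤ cge C s

def shf (A : Finset ℕ) : Finset ℕ := (A.filter (fun a => 1 ≤ a)).image (fun a => a - 1)

theorem cge_zero (C : Finset ℕ) : cge C 0 = C.card := by simp [cge]

theorem mem_shf {A : Finset ℕ} {a : ℕ} : a ∈ shf A ↔ a + 1 ∈ A := by
  simp only [shf, mem_image, mem_filter]
  constructor
  · rintro ⟨b, ⟨hb, h1⟩, rfl⟩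
    rwa [Nat.sub_add_cancel h1]
  · intro h
    exact ⟨a + 1, ⟨h, by omega⟩, by omega⟩

theorem cge_shf (A : Finset ℕ) (x : ℕ) : cge (shf A) x = cge A (x + 1) := by
  unfold cge
  refine card_bij (fun a _ => a + 1) ?_ ?_ ?_
  · intro a ha
    rw [mem_filter, mem_shf] at ha
    rw [mem_filter]
    exact ⟨ha.1, by omega⟩
  · intro a _ b _ h; omega
  · intro b hb
    rw [mem_filter] at hb
    refine ⟨b - 1, ?_, by omega⟩
    rw [mem_filter, mem_shf, show b - 1 + 1 = b by omega]
    exact ⟨hb.1, by omega⟩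

theorem cge_erase (C : Finset ℕ) (s : ℕ) : cge (C.erase 0) (s + 1) = cge C (s + 1) := by
  unfold cge
  congr 1
  ext c
  simp only [mem_filter, mem_erase]
  constructor
  · rintro ⟨⟨_, h⟩, h'⟩; exact ⟨h, h'⟩
  · rintro ⟨h, h'⟩; exact ⟨⟨by omega, h⟩, h'⟩

theorem shf_erase (A : Finset ℕ) : shf (A.erase 0) = shf A := by
  ext a; simp [mem_shf]

theorem cge_anti (C : Finset ℕ) {s t : ℕ} (h : s ≤ t) : cge C t ≤ cge C s :=
  card_le_card fun c hc => by
    rw [mem_filter] at hc ⊢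
    exact ⟨hc.1, h.trans hc.2⟩

theorem le_em_iff {C : Finset ℕ} {k : ℕ} (h : C.card = k) (s : ℕ) (i : Fin k) :
    s ≤ em C k i ↔ k - i ≤ cge C s := by
  rw [cge, card_filter_em h]
  constructor
  · intro hs
    rw [← Fin.card_Ici]
    refine card_le_card fun j hj => ?_
    rw [mem_Ici] at hj
    rw [mem_filter]
    exact ⟨mem_univ _, hs.trans ((em_strictMono h).monotone hj)⟩
  · intro hs
    by_contra hlt
    have : (univ.filter (fun j => s ≤ em C k j)).card ≤ (Ioi i).card := by
      refine card_le_card fun j hj => ?_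
      rw [mem_filter] at hj
      rw [mem_Ioi]
      by_contra hji
      exact hlt (hj.2.trans ((em_strictMono h).monotone (not_lt.1 hji)))
    rw [Fin.card_Ioi] at this
    have := i.2
    omega

theorem nxt_iff {C C' : Finset ℕ} {k : ℕ} (h : C.card = k) (h' : C'.card = k) :
    nxt C C' ↔ ∀ i, em C' k i ≤ em C k i ∧ em C k i ≤ em C' k i + 1 := by
  constructor
  · intro H i
    constructor
    · rw [le_em_iff h]
      exact ((le_em_iff h' _ i).1 le_rfl).trans (H _).2
    · by_cases h0 : em C k i = 0
      · omega
      · obtain ⟨s, hs⟩ := Nat.exists_eq_succ_of_ne_zero h0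
        have h1 := (le_em_iff h (s + 1) i).1 (by omega)
        have := (le_em_iff h' s i).2 (h1.trans (H s).1)
        omega
  · intro H s
    simp only [cge, card_filter_em h, card_filter_em h']
    constructor
    · refine card_le_card fun i hi => ?_
      rw [mem_filter] at hi ⊢
      have := H i
      exact ⟨mem_univ _, by omega⟩
    · refine card_le_card fun i hi => ?_
      rw [mem_filter] at hi ⊢
      have := H i
      exact ⟨mem_univ _, by omega⟩

open Classical in
noncomputable def nexts (C : Finset ℕ) : Finset (Finset ℕ) :=
  ((range (C.sup id + 1)).powerset).filter (fun C' => nxt C C')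

theorem mem_nexts {C C' : Finset ℕ} : C' ∈ nexts C ↔ nxt C C' := by
  classical
  simp only [nexts, mem_filter, mem_powerset, and_iff_right_iff_imp]
  intro h c hc
  rw [mem_range]
  by_contra hlt
  have h1 : 0 < cge C' (C.sup id + 1) := card_pos.2 ⟨c, mem_filter.2 ⟨hc, not_lt.1 hlt⟩⟩
  have h2 := (h (C.sup id + 1)).2
  obtain ⟨d, hd⟩ := card_pos.1 (h1.trans_le h2)
  rw [mem_filter] at hd
  have := le_sup (f := id) hd.1
  simp only [id] at this
  omega

/-- determinant of binomial coefficients -/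
noncomputable def dd (C A : Finset ℕ) : ℚ :=
  if C.card = A.card then
    det (of fun i j : Fin A.card => ((em A A.card j).choose (em C A.card i) : ℚ)) else 0

theorem dd_eq {C A : Finset ℕ} {k : ℕ} (hC : C.card = k) (hA : A.card = k) :
    dd C A = det (of fun i j : Fin k => ((em A k j).choose (em C k i) : ℚ)) := by
  subst hA
  rw [dd, if_pos hC]

theorem det_step {k : ℕ} (u v : Fin k → ℕ) (hu : StrictMono u) [DecidablePred (StrictMono : (Fin k → ℕ) → Prop)] :
    det (of fun i j => ((v j + 1).choose (u i) : ℚ)) =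
      ∑ r ∈ (Fintype.piFinset (fun i => ({u i - 1, u i} : Finset ℕ))).filter StrictMono,
        det (of fun i j => ((v j).choose (r i) : ℚ)) := by
  have e : (of fun i j => ((v j + 1).choose (u i) : ℚ) : Matrix (Fin k) (Fin k) ℚ) =
      of fun i => ∑ b ∈ ({u i - 1, u i} : Finset ℕ), fun j => ((v j).choose b : ℚ) := by
    ext i j
    simp only [of_apply, Finset.sum_apply]
    rcases h : u i with _ | a
    · simp
    · rw [sum_pair (by omega), Nat.choose_succ_succ]
      simp
  rw [e]
  have h := MultilinearMap.map_sum_finset (detRowAlternating (n := Fin k) (R := ℚ)).toMultilinearMap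
      (fun (_ : Fin k) (b : ℕ) => (fun j => ((v j).choose b : ℚ))) (fun i => {u i - 1, u i})
  refine Eq.trans h ?_
  rw [sum_filter]
  refine sum_congr rfl fun r hr => ?_
  split_ifs with hs
  · rfl
  · rw [Fintype.mem_piFinset] at hr
    have hmono : Monotone r := by
      intro i j hij
      rcases hij.eq_or_lt with rfl | hij
      · exact le_rfl
      · have h1 := hr i
        have h2 := hr j
        have h3 := hu hij
        simp only [mem_insert, mem_singleton] at h1 h2
        omega
    have : ¬ Function.Injective r := fun hi => hs (hmono.strictMono_of_injective hi)
    simp only [Function.Injective, not_forall] at this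
    obtain ⟨a, b, hab, hne⟩ := this
    exact det_zero_of_row_eq (M := of fun i j => ((v j).choose (r i) : ℚ)) hne
      (by ext; simp [hab])

theorem em_shf {A : Finset ℕ} {k : ℕ} (hA : A.card = k) (h0 : 0 ∉ A) (j : Fin k) :
    em A k j = em (shf A) k j + 1 := by
  have h1 : ∀ j, 1 ≤ em A k j := fun j => by
    have := em_mem hA j
    rcases h : em A k j with _ | a
    · rw [h] at this; exact absurd this h0
    · omega
  have hm : StrictMono (fun j => em A k j - 1) := by
    intro i j hij
    have := em_strictMono hA hij
    have := h1 i
    show em A k i - 1 < em A k j - 1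
    omega
  have him : univ.image (fun j => em A k j - 1) = shf A := by
    ext a
    rw [mem_shf, mem_image]
    constructor
    · rintro ⟨j, _, rfl⟩
      rw [Nat.sub_add_cancel (h1 j)]; exact em_mem hA j
    · intro ha
      obtain ⟨j, hj⟩ := em_exists hA ha
      exact ⟨j, mem_univ _, by omega⟩
  have := em_unique hm
  rw [him] at this
  rw [this]
  have := h1 j
  show _ = em A k j - 1 + 1
  omega

theorem card_shf {A : Finset ℕ} (h0 : 0 ∉ A) : (shf A).card = A.card := by
  rw [← cge_zero, cge_shf, ← cge_erase, ← cge_zero A, erase_eq_of_notMem h0]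
  unfold cge
  congr 1
  ext a
  simp only [mem_filter]
  constructor
  · rintro ⟨h, _⟩; exact ⟨h, by omega⟩
  · rintro ⟨h, _⟩
    refine ⟨h, ?_⟩
    rcases a with _ | a
    · exact absurd h h0
    · omega

theorem dd_step1 {C A : Finset ℕ} (h0 : 0 ∉ A) (hc : C.card = A.card) :
    dd C A = ∑ C' ∈ nexts C, dd C' (shf A) := by
  classical
  have hs := card_shf h0
  rw [dd_eq hc rfl]
  have e : (of fun i j : Fin A.card => ((em A A.card j).choose (em C A.card i) : ℚ)) =
      of fun i j : Fin A.card => ((em (shf A) A.card j + 1).choose (em C A.card i) : ℚ) := by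
    ext i j
    simp only [of_apply]
    rw [em_shf rfl h0]
  rw [e, det_step _ _ (em_strictMono hc)]
  have : ∑ C' ∈ nexts C, dd C' (shf A) = ∑ C' ∈ (nexts C).filter (fun C' => C'.card = A.card),
      dd C' (shf A) := by
    rw [sum_filter]
    refine sum_congr rfl fun C' _ => ?_
    split_ifs with h
    · rfl
    · rw [dd, if_neg (by rwa [hs])]
  rw [this]
  refine sum_bij (fun r _ => univ.image r) ?_ ?_ ?_ ?_
  · intro r hr
    rw [mem_filter, Fintype.mem_piFinset] at hr
    have hk : (univ.image r).card = A.card := by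
      rw [card_image_of_injective _ hr.2.injective]; simp
    rw [mem_filter, mem_nexts, nxt_iff hc hk, em_unique hr.2]
    refine ⟨fun i => ?_, hk⟩
    have := hr.1 i
    simp only [mem_insert, mem_singleton] at this
    omega
  · intro r hr r' hr' h
    rw [mem_filter] at hr hr'
    rw [← em_unique hr.2, h, em_unique hr'.2]
  · intro C' hC'
    rw [mem_filter, mem_nexts] at hC'
    have H := (nxt_iff hc hC'.2).1 hC'.1
    refine ⟨em C' A.card, ?_, em_image hC'.2⟩
    rw [mem_filter, Fintype.mem_piFinset]
    refine ⟨fun i => ?_, em_strictMono hC'.2⟩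
    have := H i
    simp only [mem_insert, mem_singleton]
    omega
  · intro r hr
    rw [mem_filter] at hr
    have hk : (univ.image r).card = A.card := by
      rw [card_image_of_injective _ hr.2.injective]; simp
    rw [dd_eq hk hs, em_unique hr.2]

theorem em_erase {C : Finset ℕ} {k : ℕ} (hC : C.card = k + 1) (h0 : 0 ∈ C) :
    em C (k + 1) 0 = 0 ∧ ∀ j : Fin k, em C (k + 1) j.succ = em (C.erase 0) k j := by
  have hz : em C (k + 1) 0 = 0 := by
    obtain ⟨j, hj⟩ := em_exists hC h0
    have := (em_strictMono hC).monotone (Fin.zero_le j)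
    omega
  refine ⟨hz, ?_⟩
  have hm : StrictMono (fun j : Fin k => em C (k + 1) j.succ) := fun i j hij =>
    em_strictMono hC (Fin.succ_lt_succ_iff.2 hij)
  have him : univ.image (fun j : Fin k => em C (k + 1) j.succ) = C.erase 0 := by
    ext c
    rw [mem_image, mem_erase]
    constructor
    · rintro ⟨j, _, rfl⟩
      refine ⟨?_, em_mem hC _⟩
      have := em_strictMono hC (Fin.succ_pos j)
      omega
    · rintro ⟨hc, hcC⟩
      obtain ⟨j, hj⟩ := em_exists hC hcC
      rcases Fin.eq_zero_or_eq_succ j with rfl | ⟨j', rfl⟩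
      · omega
      · exact ⟨j', mem_univ _, hj⟩
  have := em_unique hm
  rw [him] at this
  intro j
  rw [this]

theorem dd_step2 {C A : Finset ℕ} (h0 : 0 ∈ A) (hc : C.card = A.card) :
    dd C A = if 0 ∈ C then dd (C.erase 0) (A.erase 0) else 0 := by
  obtain ⟨k, hk⟩ : ∃ k, A.card = k + 1 := Nat.exists_eq_succ_of_ne_zero (card_pos.2 ⟨0, h0⟩).ne'
  have hA := em_erase hk h0
  rw [hk] at hc
  rw [dd_eq hc hk]
  split_ifs with hC
  · have hC' := em_erase hc hC
    rw [dd_eq (k := k) (by rw [card_erase_of_mem hC, hc]; rfl) (by rw [card_erase_of_mem h0, hk]; rfl),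
      det_succ_column_zero, sum_eq_single 0]
    · simp only [of_apply, hA.1, hC'.1]
      simp only [Fin.val_zero, pow_zero, Nat.choose_self, Nat.cast_one, mul_one, one_mul, Fin.succAbove_zero]
      congr 1
      ext i j
      simp [hA.2, hC'.2]
    · intro i _ hi
      obtain ⟨i', rfl⟩ := Fin.exists_succ_eq.2 hi
      have := em_strictMono hc (Fin.succ_pos i')
      simp only [of_apply, hA.1]
      rw [Nat.choose_eq_zero_of_lt (by omega)]
      simp
    · simp
  · refine det_eq_zero_of_column_eq_zero 0 fun i => ?_
    simp only [of_apply, hA.1]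
    rw [Nat.choose_eq_zero_of_lt]
    · simp
    · have := em_mem hc i
      rcases h : em C (k + 1) i with _ | a
      · rw [h] at this; exact absurd this hC
      · omega

theorem dd_step {C A : Finset ℕ} (hc : C.card = A.card) :
    dd C A = ∑ C' ∈ nexts C, dd C' (shf A) := by
  classical
  by_cases h0 : 0 ∈ A
  · rw [dd_step2 h0 hc]
    have hsc : (shf A).card = A.card - 1 := by
      rw [← shf_erase, card_shf (by simp), card_erase_of_mem h0]
    have hpos : 0 < A.card := card_pos.2 ⟨0, h0⟩
    split_ifs with hC
    · have hce : (C.erase 0).card = (A.erase 0).card := by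
        rw [card_erase_of_mem h0, card_erase_of_mem hC, hc]
      have hce' : (C.erase 0).card = C.card - 1 := card_erase_of_mem hC
      rw [dd_step1 (by simp) hce, shf_erase]
      have key : ∀ C' : Finset ℕ, C'.card = (shf A).card → (nxt (C.erase 0) C' ↔ nxt C C') := by
        intro C' h'
        have hk : ∀ s, cge (C.erase 0) s ≤ cge C s := fun s =>
          card_le_card (filter_subset_filter _ (erase_subset _ _))
        constructor
        · intro H s
          refine ⟨?_, (H s).2.trans (hk s)⟩
          rw [← cge_erase]; exact (H s).1
        · intro H s
          refine ⟨?_, ?_⟩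
          · rw [cge_erase]; exact (H s).1
          · rcases s with _ | s
            · rw [cge_zero, cge_zero]; omega
            · rw [cge_erase]; exact (H _).2
      have e : ∀ B : Finset ℕ, ∑ C' ∈ nexts B, dd C' (shf A) =
          ∑ C' ∈ (nexts B).filter (fun C' => C'.card = (shf A).card), dd C' (shf A) := by
        intro B
        rw [sum_filter]
        refine sum_congr rfl fun C' _ => ?_
        split_ifs with h
        · rfl
        · rw [dd, if_neg h]
      rw [e, e]
      refine sum_congr ?_ fun _ _ => rfl
      ext C'
      simp only [mem_filter, mem_nexts]
      constructor
      · rintro ⟨h1, h2⟩; exact ⟨(key C' h2).1 h1, h2⟩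
      · rintro ⟨h1, h2⟩; exact ⟨(key C' h2).2 h1, h2⟩
    · symm
      refine sum_eq_zero fun C' hC' => ?_
      rw [mem_nexts] at hC'
      rw [dd, if_neg]
      intro h
      have h1 := (hC' 0).1
      rw [← cge_erase, erase_eq_of_notMem hC, cge_zero] at h1
      have h2 : cge C 1 = C.card := by
        rw [cge, filter_true_of_mem]
        intro c hcC
        rcases c with _ | c
        · exact absurd hcC hC
        · omega
      rw [zero_add, h2] at h1
      omega
  · exact dd_step1 h0 hc

/-- sequences of particle configurations -/
def Chain (C A : Finset ℕ) : Type :=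
  {c : ℕ → Finset ℕ // c 0 = C ∧ (∀ x, nxt (c x) (c (x + 1))) ∧ ∀ x, (c x).card = cge A x}

def chainEquiv {C A : Finset ℕ} (h : C.card = A.card) :
    Chain C A ≃ Σ C' : {C' // C' ∈ nexts C}, Chain C'.1 (shf A) where
  toFun c := ⟨⟨c.1 1, mem_nexts.2 (by have := c.2.2.1 0; rwa [c.2.1] at this)⟩,
    ⟨fun x => c.1 (x + 1), rfl, fun x => c.2.2.1 (x + 1), fun x => by
      rw [cge_shf]; exact c.2.2.2 (x + 1)⟩⟩
  invFun p := ⟨fun x => match x with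
      | 0 => C
      | x + 1 => p.2.1 x, rfl, fun x => by
        rcases x with _ | x
        · show nxt C (p.2.1 0)
          rw [p.2.2.1]; exact mem_nexts.1 p.1.2
        · exact p.2.2.2.1 x, fun x => by
        rcases x with _ | x
        · rw [cge_zero]; exact h
        · rw [← cge_shf]; exact p.2.2.2.2 x⟩
  left_inv c := by
    apply Subtype.ext
    funext x
    rcases x with _ | x
    · exact c.2.1.symm
    · rfl
  right_inv p := by
    obtain ⟨⟨C', hC'⟩, ⟨c, hc, h1, h2⟩⟩ := p
    change c 0 = C' at hc
    subst hc
    rfl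

theorem chain_card (n : ℕ) (C A : Finset ℕ) (hA : A ⊆ range n) :
    Finite (Chain C A) ∧ (Nat.card (Chain C A) : ℚ) = dd C A := by
  induction n generalizing C A with
  | zero =>
    have hA0 : A = ∅ := by simpa using hA
    subst hA0
    have hall : ∀ c : Chain C ∅, ∀ x, c.1 x = ∅ := fun c x => by
      have := c.2.2.2 x
      rw [← card_eq_zero, this]; simp [cge]
    by_cases hC : C = ∅
    · subst hC
      have hsub : Subsingleton (Chain ∅ ∅) := ⟨fun a b => Subtype.ext (funext fun x => by
        rw [hall, hall])⟩
      have hne : Nonempty (Chain ∅ ∅) := ⟨⟨fun _ => ∅, rfl, fun _ s => ⟨by simp [cge], by simp [cge]⟩,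
        fun _ => by simp [cge]⟩⟩
      refine ⟨inferInstance, ?_⟩
      rw [Nat.card_eq_one_iff_unique.2 ⟨hsub, hne⟩, dd_eq (k := 0) rfl rfl]
      simp
    · have : IsEmpty (Chain C ∅) := ⟨fun c => hC (by rw [← c.2.1, hall])⟩
      refine ⟨inferInstance, ?_⟩
      rw [dd, if_neg (by simpa using hC)]
      simp
  | succ n ih =>
    by_cases h : C.card = A.card
    · have hs : shf A ⊆ range n := fun a ha => by
        rw [mem_shf] at ha
        have := hA ha
        rw [mem_range] at *
        omega
      have fin : ∀ C' : {C' // C' ∈ nexts C}, Finite (Chain C'.1 (shf A)) := fun C' => (ih _ _ hs).1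
      refine ⟨Finite.of_equiv _ (chainEquiv h).symm, ?_⟩
      rw [Nat.card_congr (chainEquiv h), Nat.card_sigma, dd_step h, Nat.cast_sum,
        ← sum_coe_sort (nexts C)]
      exact sum_congr rfl fun C' _ => (ih _ _ hs).2
    · have : IsEmpty (Chain C A) := ⟨fun c => h (by
        have := c.2.2.2 0
        rwa [c.2.1, cge_zero] at this)⟩
      refine ⟨inferInstance, ?_⟩
      rw [dd, if_neg h]
      simp
end Chains

section Factor
open Polynomial

/-- the polynomial `x (1 + x)` -/
noncomputable def pp : ℚ[X] := X * (1 + X)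
/-- the polynomial `1 + 2 x` -/
noncomputable def qq : ℚ[X] := 1 + 2 * X

noncomputable def xm {m : ℕ} (b : ℕ) (i : Fin m) : ℚ := (pp ^ (i : ℕ)).coeff b
noncomputable def ym {m : ℕ} (b : ℕ) (i : Fin m) : ℚ := (qq * pp ^ (i : ℕ)).coeff b

theorem refl_coeff (n : ℕ) (p : ℚ[X]) (hp : p.natDegree < n) (a : ℕ) :
    ∑ b ∈ range n, (-1 : ℚ) ^ b * (b.choose a : ℚ) * p.coeff b = (p.comp (-(X + 1))).coeff a := by
  rw [Polynomial.comp, eval₂_eq_sum_range' _ hp, finsetSum_coeff]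
  refine sum_congr rfl fun b _ => ?_
  rw [neg_pow (X + 1 : ℚ[X]), coeff_C_mul, show ((-1 : ℚ[X]) ^ b) = C ((-1) ^ b) by simp, coeff_C_mul,
    coeff_X_add_one_pow]
  ring

theorem pp_comp : pp.comp (-(X + 1)) = pp := by
  simp [pp]; ring

theorem qq_comp : qq.comp (-(X + 1)) = -qq := by
  simp [qq]; ring

theorem pp_natDegree : pp.natDegree = 2 := by
  rw [pp]; compute_degree!

theorem pp_monic : pp.Monic := by
  rw [pp, add_comm]
  exact monic_X.mul (by simpa using monic_X_add_C (1 : ℚ))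

theorem qq_natDegree : qq.natDegree = 1 := by
  rw [qq]; compute_degree!

theorem qq_lead : qq.leadingCoeff = 2 := by
  rw [leadingCoeff, qq_natDegree, qq, coeff_add, ← C_1, coeff_C, show (2 : ℚ[X]) = C 2 from rfl,
    coeff_C_mul]
  simp

theorem ppow_natDegree (i : ℕ) : (pp ^ i).natDegree = 2 * i := by
  rw [pp_monic.natDegree_pow, pp_natDegree]; ring

theorem qpow_natDegree (i : ℕ) : (qq * pp ^ i).natDegree = 2 * i + 1 := by
  rw [natDegree_mul (by intro h; have := qq_lead; rw [h] at this; simp at this)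
    (pp_monic.pow i).ne_zero, ppow_natDegree, qq_natDegree]; ring

theorem qpow_lead (i : ℕ) : (qq * pp ^ i).leadingCoeff = 2 := by
  rw [leadingCoeff_mul, qq_lead, (pp_monic.pow i).leadingCoeff, mul_one]

theorem xm_refl {m : ℕ} (a : ℕ) (i : Fin m) :
    ∑ b ∈ range (m + m), (-1 : ℚ) ^ b * (b.choose a : ℚ) * xm b i = xm a i := by
  have := refl_coeff (m + m) (pp ^ (i : ℕ)) (by rw [ppow_natDegree]; omega) a
  rw [pow_comp, pp_comp] at this
  exact this

theorem ym_refl {m : ℕ} (a : ℕ) (i : Fin m) :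
    ∑ b ∈ range (m + m), (-1 : ℚ) ^ b * (b.choose a : ℚ) * ym b i = - ym a i := by
  have := refl_coeff (m + m) (qq * pp ^ (i : ℕ)) (by rw [qpow_natDegree]; omega) a
  rw [mul_comp, pow_comp, pp_comp, qq_comp, neg_mul, coeff_neg] at this
  exact this

/-- all coefficient vectors -/
noncomputable def gmat (m : ℕ) : Matrix (Fin (m + m)) (Fin m ⊕ Fin m) ℚ :=
  of fun b c => Sum.elim (xm (b : ℕ)) (ym (b : ℕ)) c

theorem exists_interleave (m : ℕ) : ∃ g : Fin m ⊕ Fin m ≃ Fin (m + m),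
    (∀ i, (g (.inl i) : ℕ) = 2 * i) ∧ ∀ i, (g (.inr i) : ℕ) = 2 * i + 1 := by
  let g : Fin m ⊕ Fin m → Fin (m + m) := Sum.elim (fun i => ⟨2 * i, by omega⟩)
    (fun i => ⟨2 * i + 1, by omega⟩)
  have hg : Function.Bijective g := by
    rw [Fintype.bijective_iff_injective_and_card]
    refine ⟨?_, by simp⟩
    rintro (i | i) (j | j) h <;> simp [g, Fin.ext_iff] at h ⊢ <;> omega
  exact ⟨Equiv.ofBijective g hg, fun i => rfl, fun i => rfl⟩

theorem gmat_det (m : ℕ) (g : Fin m ⊕ Fin m ≃ Fin (m + m))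
    (h1 : ∀ i, (g (.inl i) : ℕ) = 2 * i) (h2 : ∀ i, (g (.inr i) : ℕ) = 2 * i + 1) :
    ((gmat m).submatrix id g.symm).det = 2 ^ m := by
  rw [det_of_isUpperTriangular]
  · rw [← Equiv.prod_comp g, Fintype.prod_sum_type]
    have e1 : ∀ i : Fin m, (gmat m).submatrix id g.symm (g (.inl i)) (g (.inl i)) = 1 := fun i => by
      simp only [submatrix_apply, id, Equiv.symm_apply_apply, gmat, of_apply, Sum.elim_inl, xm, h1]
      rw [← ppow_natDegree, coeff_natDegree, (pp_monic.pow _).leadingCoeff]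
    have e2 : ∀ i : Fin m, (gmat m).submatrix id g.symm (g (.inr i)) (g (.inr i)) = 2 := fun i => by
      simp only [submatrix_apply, id, Equiv.symm_apply_apply, gmat, of_apply, Sum.elim_inr, ym, h2]
      rw [← qpow_natDegree, coeff_natDegree, qpow_lead]
    simp only [e1, e2]
    simp
  · intro b c hbc
    obtain ⟨c, rfl⟩ := g.surjective c
    simp only [id] at hbc
    rw [Fin.lt_def] at hbc
    rcases c with i | i
    · simp only [submatrix_apply, id, Equiv.symm_apply_apply, gmat, of_apply, Sum.elim_inl, xm]
      apply coeff_eq_zero_of_natDegree_lt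
      rw [ppow_natDegree, ← h1]; exact hbc
    · simp only [submatrix_apply, id, Equiv.symm_apply_apply, gmat, of_apply, Sum.elim_inr, ym]
      apply coeff_eq_zero_of_natDegree_lt
      rw [qpow_natDegree, ← h2]; exact hbc

theorem sum_split {m : ℕ} {C A : Finset ℕ} (hC : C ⊆ range (m + m)) (hA : A = range (m + m) \ C)
    (hCm : C.card = m) (hAm : A.card = m) (f : ℕ → ℚ) :
    ∑ b ∈ range (m + m), f b = ∑ i, f (em C m i) + ∑ i, f (em A m i) := by
  rw [← sum_sdiff hC, ← hA, add_comm]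
  congr 1
  · conv_lhs => rw [← em_image hCm]
    rw [sum_image fun _ _ _ _ h => (em_strictMono hCm).injective h]
  · conv_lhs => rw [← em_image hAm]
    rw [sum_image fun _ _ _ _ h => (em_strictMono hAm).injective h]

theorem block_identity {m : ℕ} {C A : Finset ℕ} (hC : C ⊆ range (m + m))
    (hA : A = range (m + m) \ C) (hCm : C.card = m) (hAm : A.card = m) :
    (∏ j, (-1 : ℚ) ^ em A m j) * dd C A *
      (fromBlocks (of fun i j : Fin m => xm (em C m i) j) (of fun i j : Fin m => ym (em C m i) j)
        (of fun i j : Fin m => xm (em A m i) j) (of fun i j : Fin m => ym (em A m i) j)).det =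
      (-2) ^ m * (mnr (m := m) xm C * mnr (m := m) ym C) := by
  set XC := (of fun i j : Fin m => xm (em C m i) j) with hXC
  set YC := (of fun i j : Fin m => ym (em C m i) j) with hYC
  set XA := (of fun i j : Fin m => xm (em A m i) j) with hXA
  set YA := (of fun i j : Fin m => ym (em A m i) j) with hYA
  let J1 : Matrix (Fin m) (Fin m) ℚ :=
    of fun i j => (-1 : ℚ) ^ (em C m j) * ((em C m j).choose (em C m i) : ℚ)
  let J2 : Matrix (Fin m) (Fin m) ℚ :=
    of fun i j => (-1 : ℚ) ^ (em A m j) * ((em A m j).choose (em C m i) : ℚ)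
  have hJ2 : J2.det = (∏ j, (-1 : ℚ) ^ em A m j) * dd C A := by
    rw [dd_eq hCm hAm, ← det_mul_row]
    rfl
  have k1 : J1 * XC + J2 * XA = XC := by
    ext i j
    have := xm_refl (m := m) (em C m i) j
    rw [sum_split hC hA hCm hAm] at this
    exact this
  have k2 : J1 * YC + J2 * YA = -YC := by
    ext i j
    have := ym_refl (m := m) (em C m i) j
    rw [sum_split hC hA hCm hAm] at this
    exact this
  have key : fromBlocks 1 0 J1 J2 * fromBlocks XC YC XA YA =
      fromBlocks 1 0 1 1 * fromBlocks XC YC 0 ((-2 : ℚ) • YC) := by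
    rw [fromBlocks_multiply, fromBlocks_multiply, k1, k2]
    simp only [one_mul, zero_mul, add_zero, mul_zero]
    congr 1
    ext i j
    simp; ring
  have := congrArg det key
  rw [det_mul, det_mul, det_fromBlocks_zero₁₂, det_fromBlocks_zero₁₂, det_fromBlocks_zero₂₁,
    det_one, one_mul, one_mul, one_mul, det_smul, hJ2, Fintype.card_fin] at this
  rw [this, mnr, mnr]
  ring

theorem sign_value {m : ℕ} {C A : Finset ℕ} (hC : C ⊆ range (m + m))
    (hA : A = range (m + m) \ C) (hCm : C.card = m) (hAm : A.card = m)
    (σ : Equiv.Perm (Fin (m + m))) (h1 : ∀ i : Fin m, (σ (Fin.castAdd m i) : ℕ) = em C m i)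
    (h2 : ∀ i : Fin m, (σ (Fin.natAdd m i) : ℕ) = em A m i) :
    ((Equiv.Perm.sign σ : ℤ) : ℚ) = (∏ j, (-1 : ℚ) ^ em A m j) * ∏ j : Fin m, (-1 : ℚ) ^ (m + j : ℕ) := by
  have s1 : ((Equiv.Perm.sign σ : ℤ) : ℚ) = ∏ j, ∏ i, if i < j then
      (if σ i < σ j then (1 : ℚ) else -1) else 1 := by
    rw [Equiv.Perm.sign_eq_prod_prod_Iio]
    push_cast
    refine prod_congr rfl fun j _ => ?_
    rw [← prod_filter]
    have : univ.filter (fun i => i < j) = Iio j := by ext; simp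
    rw [this]
    refine prod_congr rfl fun i _ => ?_
    split_ifs <;> simp
  rw [s1, Fin.prod_univ_add, prod_eq_one, one_mul, ← prod_mul_distrib]
  · refine prod_congr rfl fun j _ => ?_
    rw [Fin.prod_univ_add]
    rw [prod_eq_one (f := fun i : Fin m => if Fin.natAdd m i < Fin.natAdd m j then _ else _), mul_one]
    · have t1 : ∀ i : Fin m, (if Fin.castAdd m i < Fin.natAdd m j then
          (if σ (Fin.castAdd m i) < σ (Fin.natAdd m j) then (1 : ℚ) else -1) else 1) =
          if ¬ em C m i < em A m j then -1 else 1 := fun i => by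
        rw [if_pos (by rw [Fin.lt_def]; simp; omega)]
        simp only [Fin.lt_def, h1, h2, ite_not]
      rw [prod_congr rfl fun i _ => t1 i, ← prod_filter, prod_const, ← pow_add]
      have c1 : (univ.filter fun i : Fin m => em C m i < em A m j).card +
          (univ.filter fun i : Fin m => ¬ em C m i < em A m j).card = m := by
        rw [card_filter_add_card_filter_not]; simp
      have c2 : (univ.filter fun i : Fin m => em C m i < em A m j).card + j = em A m j := by
        rw [← card_filter_em hCm (fun c => c < em A m j)]
        have : (A.filter (fun c => c < em A m j)).card = j := by
          rw [card_filter_em hAm (fun c => c < em A m j)]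
          have : (univ.filter fun i : Fin m => em A m i < em A m j) = Iio j := by
            ext i; simp [(em_strictMono hAm).lt_iff_lt]
          rw [this]; simp
        rw [← this, ← card_union_of_disjoint]
        · rw [← filter_union, hA, union_sdiff_of_subset hC, ← hA]
          have hj : em A m j < m + m := by
            have hs : A ⊆ range (m + m) := by rw [hA]; exact sdiff_subset
            exact mem_range.1 (hs (em_mem hAm j))
          have : (range (m + m)).filter (fun c => c < em A m j) = range (em A m j) := by
            ext c; simp; omega
          rw [this]; simp
        · refine disjoint_filter_filter ?_
          rw [hA]; exact disjoint_sdiff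
      generalize (univ.filter fun i : Fin m => em C m i < em A m j).card = p at *
      generalize (univ.filter fun i : Fin m => ¬ em C m i < em A m j).card = q at *
      rw [← c2, show p + (j : ℕ) + (m + j) = q + 2 * (p + j) by omega, pow_add, pow_mul]
      simp
    · intro i _
      split_ifs with a b
      · rfl
      · exfalso; apply b
        rw [Fin.lt_def, h2, h2]
        apply em_strictMono hAm
        simpa using a
      · rfl
  · intro j _
    apply prod_eq_one
    intro i _
    split_ifs with a b
    · rfl
    · exfalso
      apply b
      have : (i : ℕ) < m := by
        have := Fin.lt_def.1 a; simp at this; omega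
      obtain ⟨i', rfl⟩ : ∃ i', i = Fin.castAdd m i' := ⟨⟨i, this⟩, rfl⟩
      rw [Fin.lt_def, h1, h1]
      apply em_strictMono hCm
      rw [Fin.lt_def] at a ⊢
      exact a
    · rfl

theorem dd_factor (m : ℕ) : ∃ s : ℚ, (s = 1 ∨ s = -1) ∧ ∀ C ∈ powersetCard m (range (m + m)),
    dd C (range (m + m) \ C) = s * (mnr (m := m) xm C * mnr (m := m) ym C) := by
  obtain ⟨g, hg1, hg2⟩ := exists_interleave m
  have unit_sign : ∀ τ : Equiv.Perm (Fin (m + m)),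
      ((Equiv.Perm.sign τ : ℤ) : ℚ) = 1 ∨ ((Equiv.Perm.sign τ : ℤ) : ℚ) = -1 := fun τ => by
    rcases Int.units_eq_one_or (Equiv.Perm.sign τ) with h | h <;> simp [h]
  let τ : Equiv.Perm (Fin (m + m)) := g.symm.trans finSumFinEquiv
  let s1 : ℚ := ((Equiv.Perm.sign τ : ℤ) : ℚ)
  let s2 : ℚ := ∏ j : Fin m, (-1 : ℚ) ^ (m + j : ℕ)
  have hs2 : s2 = 1 ∨ s2 = -1 := by
    simp only [s2]
    rw [prod_pow_eq_pow_sum]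
    exact neg_one_pow_eq_or _ _
  have hs3 : ((-1 : ℚ) ^ m = 1 ∨ (-1 : ℚ) ^ m = -1) := neg_one_pow_eq_or _ _
  refine ⟨s1 * s2 * (-1) ^ m, ?_, ?_⟩
  · rcases unit_sign τ with h | h <;> rcases hs2 with h' | h' <;> rcases hs3 with h'' | h'' <;>
      simp only [s1, h, h', h''] <;> norm_num
  intro C hC'
  obtain ⟨hC, hCm⟩ := mem_powersetCard.1 hC'
  obtain ⟨A, hA⟩ : ∃ A, A = range (m + m) \ C := ⟨_, rfl⟩
  have hAm : A.card = m := by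
    rw [hA, card_sdiff_of_subset hC, card_range, hCm]; omega
  rw [← hA]
  have key := block_identity hC hA hCm hAm
  have hlt : ∀ {D : Finset ℕ}, D ⊆ range (m + m) → D.card = m → ∀ i, em D m i < m + m :=
    fun hD hDm i => mem_range.1 (hD (em_mem hDm i))
  have hA' : A ⊆ range (m + m) := by rw [hA]; exact sdiff_subset
  let e0 : Fin m ⊕ Fin m → Fin (m + m) := Sum.elim (fun i => ⟨em C m i, hlt hC hCm i⟩)
    (fun i => ⟨em A m i, hlt hA' hAm i⟩)
  have hdis : ∀ i j, em C m i ≠ em A m j := fun i j h => by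
    have h1 := em_mem hCm i
    have h2 := em_mem hAm j
    rw [← h] at h2
    rw [hA, mem_sdiff] at h2
    exact h2.2 h1
  have he0 : Function.Bijective e0 := by
    rw [Fintype.bijective_iff_injective_and_card]
    refine ⟨?_, by simp⟩
    rintro (i | i) (j | j) h <;> simp only [e0, Sum.elim_inl, Sum.elim_inr, Fin.mk.injEq] at h
    · rw [(em_strictMono hCm).injective h]
    · exact absurd h (hdis _ _)
    · exact absurd h.symm (hdis _ _)
    · rw [(em_strictMono hAm).injective h]
  let e : Fin m ⊕ Fin m ≃ Fin (m + m) := Equiv.ofBijective e0 he0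
  let σ : Equiv.Perm (Fin (m + m)) := finSumFinEquiv.symm.trans e
  have hσv : ∀ s, σ (finSumFinEquiv s) = e s := fun s => by simp [σ]
  have hσ := sign_value hC hA hCm hAm σ
    (fun i => by rw [← finSumFinEquiv_apply_left, hσv]; rfl)
    (fun i => by rw [← finSumFinEquiv_apply_right, hσv]; rfl)
  have hdet : (fromBlocks (of fun i j : Fin m => xm (em C m i) j)
        (of fun i j : Fin m => ym (em C m i) j)
        (of fun i j : Fin m => xm (em A m i) j) (of fun i j : Fin m => ym (em A m i) j)).det =
      ((Equiv.Perm.sign σ : ℤ) : ℚ) * s1 * 2 ^ m := by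
    have e1 : fromBlocks (of fun i j : Fin m => xm (em C m i) j)
        (of fun i j : Fin m => ym (em C m i) j)
        (of fun i j : Fin m => xm (em A m i) j) (of fun i j : Fin m => ym (em A m i) j) =
        ((((gmat m).submatrix id g.symm).submatrix (τ.trans σ) id).submatrix g g) := by
      have hv : ∀ s, (τ.trans σ) (g s) = e s := fun s => by simp [τ, σ]
      ext a b
      simp only [submatrix_apply, id, hv, Equiv.symm_apply_apply]
      rcases a with i | i <;> rcases b with j | j <;> rfl
    rw [e1, det_submatrix_equiv_self, det_permute, gmat_det m g hg1 hg2, Equiv.Perm.sign_trans]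
    push_cast
    simp only [s1]
  rw [hdet, hσ] at key
  have hw : (∏ j, (-1 : ℚ) ^ em A m j) * (∏ j, (-1 : ℚ) ^ em A m j) = 1 := by
    rw [← prod_mul_distrib]
    apply prod_eq_one
    intro j _
    rw [← mul_pow]; simp
  have h1 : s1 * s1 = 1 := by rcases unit_sign τ with h | h <;> simp only [s1, h] <;> norm_num
  have h2 : s2 * s2 = 1 := by rcases hs2 with h | h <;> rw [h] <;> norm_num
  have key2 : dd C A * (s1 * s2) * 2 ^ m =
      (-2) ^ m * (mnr (m := m) xm C * mnr (m := m) ym C) := by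
    rw [← key]
    have : dd C A * (s1 * s2) * 2 ^ m = ((∏ j, (-1 : ℚ) ^ em A m j) * (∏ j, (-1 : ℚ) ^ em A m j)) *
      (dd C A * (s1 * s2) * 2 ^ m) := by rw [hw, one_mul]
    rw [this]; ring
  have h3 : dd C A * (s1 * s2) = (-1) ^ m * (mnr (m := m) xm C * mnr (m := m) ym C) := by
    have h2m : (2 : ℚ) ^ m ≠ 0 := by positivity
    apply mul_right_cancel₀ h2m
    rw [key2, show (-2 : ℚ) = -1 * 2 by norm_num, mul_pow]; ring
  calc dd C A = dd C A * (s1 * s2) * (s1 * s2) := by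
        rw [mul_assoc, show s1 * s2 * (s1 * s2) = (s1 * s1) * (s2 * s2) by ring, h1, h2]; ring
    _ = _ := by rw [h3]; ring

end Factor

section Gram
open Polynomial

theorem ppow_coeff (i b : ℕ) : (pp ^ i).coeff b = if i ≤ b then (i.choose (b - i) : ℚ) else 0 := by
  rw [pp, mul_pow, coeff_X_pow_mul', coeff_one_add_X_pow]

theorem ppow_coeff_symm {i b : ℕ} (h : b ≤ 3 * i) :
    (pp ^ i).coeff b = (pp ^ i).coeff (3 * i - b) := by
  rw [ppow_coeff, ppow_coeff]
  by_cases h1 : b < i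
  · rw [if_neg (by omega), if_pos (by omega), Nat.choose_eq_zero_of_lt (by omega)]; simp
  · by_cases h2 : 2 * i < b
    · rw [if_pos (by omega), if_neg (by omega), Nat.choose_eq_zero_of_lt (by omega)]; simp
    · rw [if_pos (by omega), if_pos (by omega), ← Nat.choose_symm (by omega)]
      congr 2
      omega

theorem gram_coeff {m : ℕ} (i j : Fin m) :
    ∑ b ∈ range (m + m), xm b i * ym b j = (qq * pp ^ (i + j : ℕ)).coeff (3 * i) := by
  have h0 : ∀ b, 2 * (i : ℕ) < b → (pp ^ (i : ℕ)).coeff b = 0 := fun b hb =>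
    coeff_eq_zero_of_natDegree_lt (by rw [ppow_natDegree]; exact hb)
  rw [show qq * pp ^ (i + j : ℕ) = (qq * pp ^ (j : ℕ)) * pp ^ (i : ℕ) by rw [pow_add]; ring, coeff_mul,
    Nat.sum_antidiagonal_eq_sum_range_succ (fun a b => (qq * pp ^ (j : ℕ)).coeff a *
      (pp ^ (i : ℕ)).coeff b)]
  have e1 : ∑ b ∈ range (m + m), xm b i * ym b j = ∑ b ∈ range (2 * (i : ℕ) + 1), xm b i * ym b j := by
    symm
    apply sum_subset
    · intro b hb; rw [mem_range] at *; omega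
    · intro b _ hb
      rw [mem_range] at hb
      rw [xm, h0 b (by omega), zero_mul]
  have e2 : ∑ b ∈ range (3 * (i : ℕ) + 1), xm b i * ym b j =
      ∑ b ∈ range (2 * (i : ℕ) + 1), xm b i * ym b j := by
    symm
    apply sum_subset
    · intro b hb; rw [mem_range] at *; omega
    · intro b _ hb
      rw [mem_range] at hb
      rw [xm, h0 b (by omega), zero_mul]
  rw [e1, ← e2]
  refine sum_congr rfl fun b hb => ?_
  rw [mem_range] at hb
  rw [← ppow_coeff_symm (by omega), mul_comm]
  rfl

theorem qpow_coeff (N d : ℕ) : (qq * pp ^ N).coeff d = (if N ≤ d then (N.choose (d - N) : ℚ) else 0) +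
    2 * (if N + 1 ≤ d then (N.choose (d - (N + 1)) : ℚ) else 0) := by
  have : qq * pp ^ N = pp ^ N + C 2 * (X ^ (N + 1) * (1 + X) ^ N) := by
    rw [qq, pp, show (2 : ℚ[X]) = C 2 from rfl, mul_pow, pow_succ]; ring
  rw [this, coeff_add, coeff_C_mul, ppow_coeff, coeff_X_pow_mul', coeff_one_add_X_pow]

theorem choose_fac (a b N : ℕ) (h : N + 1 = a + b) :
    N.choose a * (a.factorial * b.factorial) = N.factorial * b := by
  rcases b with _ | b
  · rw [Nat.choose_eq_zero_of_lt (by omega)]; simp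
  · obtain rfl : N = b + a := by omega
    have := Nat.add_choose_mul_factorial_mul_factorial b a
    rw [← this, Nat.factorial_succ]; ring

theorem gram_fac (i j : ℕ) : (qq * pp ^ (i + j)).coeff (3 * i) *
    ((2 * i).factorial * (2 * j + 1).factorial) =
    (3 * i + 1) * ((i + j).factorial * (2 * i).descFactorial j * (2 * j + 1).descFactorial i) := by
  rw [qpow_coeff]
  by_cases h1 : 2 * i < j
  · rw [if_neg (by omega), if_neg (by omega), Nat.descFactorial_eq_zero_iff_lt.2 h1]; simp
  by_cases h2 : 2 * j + 1 < i
  · rw [Nat.choose_eq_zero_of_lt (by omega), Nat.choose_eq_zero_of_lt (n := i + j)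
      (k := 3 * i - (i + j + 1)) (by omega), Nat.descFactorial_eq_zero_iff_lt.2 h2]; simp
  obtain ⟨a, ha⟩ : ∃ a, 2 * i = j + a := ⟨2 * i - j, by omega⟩
  obtain ⟨b, hb⟩ : ∃ b, 2 * j + 1 = i + b := ⟨2 * j + 1 - i, by omega⟩
  rw [← Nat.factorial_mul_descFactorial (n := 2 * i) (k := j) (by omega),
    ← Nat.factorial_mul_descFactorial (n := 2 * j + 1) (k := i) (by omega),
    show 2 * i - j = a by omega, show 2 * j + 1 - i = b by omega, if_pos (by omega),
    show 3 * i - (i + j) = a by omega]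
  have k1 : (((i + j).choose a : ℕ) : ℚ) * (a.factorial * b.factorial) = (i + j).factorial * b := by
    exact_mod_cast choose_fac a b (i + j) (by omega)
  have k2 : (if i + j + 1 ≤ 3 * i then (((i + j).choose (3 * i - (i + j + 1)) : ℕ) : ℚ) else 0) *
      (a.factorial * b.factorial) = (i + j).factorial * a := by
    rcases a with _ | a
    · rw [if_neg (by omega)]; simp
    · rw [if_pos (by omega), show 3 * i - (i + j + 1) = a by omega,
        ← Nat.choose_symm (by omega), show i + j - a = b by omega,
        mul_comm ((a + 1).factorial : ℚ)]
      exact_mod_cast choose_fac b (a + 1) (i + j) (by omega)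
  have k3 : (3 * i + 1 : ℚ) = b + 2 * a := by
    have : 3 * i + 1 = b + 2 * a := by omega
    exact_mod_cast this
  rw [k3]
  push_cast
  linear_combination ((2 * i).descFactorial j * (2 * j + 1).descFactorial i : ℚ) * (k1 + 2 * k2)

theorem asc_fac (n k : ℕ) : asc ((n : ℚ) + 1) k * n.factorial = (n + k).factorial := by
  induction k with
  | zero => simp [asc]
  | succ k ih =>
    rw [asc_succ, ← add_assoc n k 1, Nat.factorial_succ]
    push_cast
    rw [← ih]; ring

theorem dsc_desc (n k : ℕ) : dsc (n : ℚ) k = n.descFactorial k := by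
  rw [Nat.descFactorial_eq_prod_range, dsc]
  induction k with
  | zero => simp
  | succ k ih =>
    rw [prod_range_succ, prod_range_succ, Nat.cast_mul, ih]
    by_cases h : k ≤ n
    · rw [Nat.cast_sub h]
    · have : ∏ i ∈ range k, (n - i) = 0 := prod_eq_zero (i := n) (by rw [mem_range]; omega) (by simp)
      rw [this]; simp

theorem prod_fac (m : ℕ) : (∏ i ∈ range m, (i.factorial : ℚ)) * ∏ i ∈ range m, ((i + m).factorial : ℚ) =
    ∏ i ∈ range m, (((2 * i).factorial : ℚ) * (2 * i + 1).factorial) := by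
  have h1 : ∏ i ∈ range (m + m), (i.factorial : ℚ) =
      (∏ i ∈ range m, (i.factorial : ℚ)) * ∏ i ∈ range m, ((i + m).factorial : ℚ) := by
    rw [prod_range_add]
    simp only [add_comm m]
  rw [← h1, ← two_mul]
  clear h1
  induction m with
  | zero => simp
  | succ m ih =>
    rw [show 2 * (m + 1) = 2 * m + 1 + 1 by ring, prod_range_succ, prod_range_succ, ih, prod_range_succ]
    ring

theorem gram_det (m : ℕ) :
    det (of fun i j : Fin m => ∑ b ∈ range (m + m), xm b i * ym b j) =
      ∏ i ∈ range m, (Nat.factorial (3 * i + 1) : ℚ) ^ 2 / (Nat.factorial (i + m) : ℚ) ^ 2 := by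
  have hf : ∀ k : ℕ, (k.factorial : ℚ) ≠ 0 := fun k => by exact_mod_cast k.factorial_ne_zero
  have e : (of fun i j : Fin m => ∑ b ∈ range (m + m), xm b i * ym b j) =
      fun i j : Fin m => 1 * ((3 * (i : ℕ) + 1 : ℚ) / (2 * (i : ℕ)).factorial) *
        (1 / ((2 * (j : ℕ) + 1).factorial : ℚ)) * kmat m (0 : ℚ) 1 i j := by
    funext i j
    rw [of_apply, gram_coeff]
    have g := gram_fac i j
    have k : kmat m (0 : ℚ) 1 i j = ((i + j : ℕ).factorial * (2 * (i : ℕ)).descFactorial j *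
        (2 * (j : ℕ) + 1).descFactorial i : ℚ) := by
      rw [kmat, ← dsc_desc, ← dsc_desc]
      have a := asc_fac 0 (i + j)
      simp only [Nat.cast_zero, zero_add, Nat.factorial_zero, Nat.cast_one, mul_one] at a
      rw [zero_add, a]
      push_cast
      rw [zero_add, add_comm (1 : ℚ)]
    rw [k]
    have := hf (2 * i)
    have := hf (2 * j + 1)
    field_simp
    linear_combination g
  rw [e, det_mul_row_col, kmat_det, one_pow, one_mul,
    Fin.prod_univ_eq_prod_range (fun i : ℕ => (3 * i + 1 : ℚ) / (2 * i).factorial),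
    Fin.prod_univ_eq_prod_range (fun i : ℕ => 1 / ((2 * i + 1).factorial : ℚ)), kval, fct, bet, alp,
    alp, ← prod_mul_distrib, ← prod_mul_distrib, ← prod_mul_distrib, ← prod_mul_distrib,
    ← prod_mul_distrib]
  have t : ∀ i ∈ range m, (3 * i + 1 : ℚ) / (2 * i).factorial * (1 / ((2 * i + 1).factorial : ℚ)) *
      (i.factorial * asc (0 + 1 : ℚ) i * asc (2 * 0 + 1 + 2 * i : ℚ) i * asc (0 + 2 * 1 + 2 * i : ℚ) i) =
      ((3 * i + 1).factorial : ℚ) ^ 2 * ((i.factorial : ℚ) / ((2 * i).factorial * (2 * i + 1).factorial)) ^ 2 := by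
    intro i _
    have a1 := asc_fac 0 i
    have a2 := asc_fac (2 * i) i
    have a3 := asc_fac (2 * i + 1) i
    rw [show 2 * i + 1 + i = 3 * i + 1 by ring] at a3
    rw [show 2 * i + i = 3 * i by ring] at a2
    have a4 : ((3 * i + 1).factorial : ℚ) = (3 * i + 1) * (3 * i).factorial := by
      rw [Nat.factorial_succ]; push_cast; ring
    push_cast at a1 a2 a3
    rw [zero_add, zero_add] at a1
    rw [Nat.factorial_zero, Nat.cast_one, mul_one] at a1
    rw [show (0 + 1 : ℚ) = 1 by norm_num, show (2 * 0 + 1 + 2 * i : ℚ) = 2 * i + 1 by ring,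
      show (0 + 2 * 1 + 2 * i : ℚ) = 2 * i + 1 + 1 by ring, a1, eq_div_of_mul_eq (hf _) a2,
      eq_div_of_mul_eq (hf _) a3]
    have := hf (2 * i)
    have := hf (2 * i + 1)
    field_simp
    rw [a4]
  rw [prod_congr rfl t, prod_mul_distrib, prod_div_distrib, prod_pow, prod_pow, prod_pow, prod_div_distrib,
    ← prod_fac]
  have : ∏ i ∈ range m, (i.factorial : ℚ) ≠ 0 := prod_ne_zero_iff.2 fun i _ => hf i
  have : ∏ i ∈ range m, ((i + m).factorial : ℚ) ≠ 0 := prod_ne_zero_iff.2 fun i _ => hf _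
  field_simp

end Gram

section PlanePart

/-- the symmetric plane partitions being counted -/
abbrev PP (n : ℕ) : Type := {S : Set (Fin n × Fin n × Fin n) // IsLowerSet S ∧
        (∀ i j k : Fin n, (i, j, k) ∈ S ↔ (j, k, i) ∈ S) ∧
        (∀ i j k : Fin n, (i, j, k) ∈ S ↔ (i.rev, j.rev, k.rev) ∉ S)}

def QC (n : ℕ) (q : ℕ → ℕ → ℕ) : Prop :=
  (∀ x s, n ≤ x + s → q x s = 0) ∧
  (∀ x s, q x (s + 1) ≤ q x s ∧ q x s ≤ q x (s + 1) + 1) ∧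
  (∀ x s, q x (s + 1) ≤ q (x + 1) s ∧ q (x + 1) s ≤ q x s) ∧
  ∀ x, x ≤ n → q x 0 + q 0 x = n - x

def inS {n : ℕ} (S : Set (Fin n × Fin n × Fin n)) (i j k : ℕ) : Prop :=
  ∃ (hi : i < n) (hj : j < n) (hk : k < n), ((⟨i, hi⟩, ⟨j, hj⟩, ⟨k, hk⟩) : Fin n × Fin n × Fin n) ∈ S

theorem inS_mono {n : ℕ} (S : PP n) {i j k i' j' k' : ℕ} (hi : i ≤ i') (hj : j ≤ j') (hk : k ≤ k')
    (h : inS S.1 i' j' k') : inS S.1 i j k := by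
  obtain ⟨a, b, c, h⟩ := h
  exact ⟨by omega, by omega, by omega, S.2.1 ⟨hi, hj, hk⟩ h⟩

theorem inS_cyc {n : ℕ} (S : PP n) (i j k : ℕ) : inS S.1 i j k ↔ inS S.1 j k i := by
  constructor
  · rintro ⟨a, b, c, h⟩; exact ⟨b, c, a, (S.2.2.1 _ _ _).1 h⟩
  · rintro ⟨a, b, c, h⟩; exact ⟨c, a, b, (S.2.2.1 _ _ _).2 h⟩

theorem inS_comp {n : ℕ} (S : PP n) {i j k : ℕ} (hi : i < n) (hj : j < n) (hk : k < n) :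
    inS S.1 i j k ↔ ¬ inS S.1 (n - 1 - i) (n - 1 - j) (n - 1 - k) := by
  have e : ∀ {a : ℕ} (ha : a < n), (⟨a, ha⟩ : Fin n).rev = ⟨n - 1 - a, by omega⟩ := fun ha => by
    ext; simp [Fin.val_rev]; omega
  have h := S.2.2.2 ⟨i, hi⟩ ⟨j, hj⟩ ⟨k, hk⟩
  rw [e, e, e] at h
  constructor
  · rintro ⟨a, b, c, h1⟩ ⟨a', b', c', h2⟩
    exact h.1 h1 h2
  · intro h1
    exact ⟨hi, hj, hk, h.2 fun h2 => h1 ⟨_, _, _, h2⟩⟩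

/-- the relation between a plane partition and its array -/
def RR (n : ℕ) (S : Set (Fin n × Fin n × Fin n)) (q : ℕ → ℕ → ℕ) : Prop :=
  ∀ x s t, x + s + t < n → (inS S (x + s + t) (x + t) t ↔ x + s + t + q x s < n)

open Classical in
noncomputable def qof {n : ℕ} (S : Set (Fin n × Fin n × Fin n)) (x s : ℕ) : ℕ :=
  ((range (n - x - s)).filter (fun t => ¬ inS S (x + s + t) (x + t) t)).card

theorem count_anti (L : ℕ) (p : ℕ → Prop) [DecidablePred p] (hp : ∀ t, p (t + 1) → p t) :
    ∀ t, t < L → (p t ↔ t + ((range L).filter (fun t => ¬ p t)).card < L) := by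
  induction L with
  | zero => intro t ht; omega
  | succ L ih =>
    have hle : ((range L).filter (fun t => ¬ p t)).card ≤ L := by
      simpa using card_filter_le (range L) (fun t => ¬ p t)
    intro t ht
    rw [range_add_one, filter_insert]
    by_cases h : p L
    · rw [if_neg (by simpa using h)]
      have hall : ∀ d a, a + d = L → p a := by
        intro d
        induction d with
        | zero => intro a ha; simp at ha; rwa [ha]
        | succ d ihd => intro a ha; exact hp _ (ihd (a + 1) (by omega))
      have : ((range L).filter (fun t => ¬ p t)) = ∅ := by
        rw [filter_eq_empty_iff]
        intro a ha
        rw [mem_range] at ha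
        simpa using hall (L - a) a (by omega)
      rw [this]
      simp only [card_empty, add_zero]
      exact ⟨fun _ => ht, fun _ => hall (L - t) t (by omega)⟩
    · rw [if_pos h, card_insert_of_notMem (by simp)]
      rcases Nat.lt_succ_iff_lt_or_eq.1 ht with h1 | h1
      · rw [ih t h1]; omega
      · rw [h1]; constructor
        · intro h'; exact absurd h' h
        · intro h'; omega

theorem qof_le {n : ℕ} (S : Set (Fin n × Fin n × Fin n)) (x s : ℕ) : qof S x s ≤ n - x - s := by
  classical
  rw [qof]
  refine (card_filter_le _ _).trans (by simp)

theorem qof_RR {n : ℕ} (S : PP n) : RR n S.1 (qof S.1) := by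
  classical
  intro x s t h
  have := count_anti (n - x - s) (fun t => inS S.1 (x + s + t) (x + t) t)
    (fun t ht => inS_mono S (by omega) (by omega) (by omega) ht) t (by omega)
  have e : qof S.1 x s = ((range (n - x - s)).filter
    (fun t => ¬ inS S.1 (x + s + t) (x + t) t)).card := by
    rw [qof]
  rw [e, this]; omega

theorem RR_unique {n : ℕ} (S : Set (Fin n × Fin n × Fin n)) (q : ℕ → ℕ → ℕ) (hq : RR n S q)
    (hle : ∀ x s, q x s ≤ n - x - s) : q = qof S := by
  classical
  funext x s
  rw [qof]
  have : (range (n - x - s)).filter (fun t => ¬ inS S (x + s + t) (x + t) t) =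
      Ico (n - x - s - q x s) (n - x - s) := by
    ext t
    rw [mem_filter, mem_range, mem_Ico]
    constructor
    · rintro ⟨h1, h2⟩
      rw [hq x s t (by omega)] at h2
      omega
    · rintro ⟨h1, h2⟩
      refine ⟨h2, ?_⟩
      rw [hq x s t (by omega)]
      omega
  rw [this, Nat.card_Ico]
  have := hle x s
  omega

theorem qof_QC {n : ℕ} (S : PP n) : QC n (qof S.1) := by
  have R := qof_RR S
  have hle := qof_le S.1
  have cmp : ∀ {x s y r : ℕ} (d : ℕ), y + r ≤ x + s + d → y ≤ x + d → y + r + 1 ≥ x + s →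
      ∀ t, x + s + (t + d) < n → y + r + t < n →
      x + s + (t + d) + qof S.1 x s < n → y + r + t + qof S.1 y r < n := by
    intro x s y r d h1 h2 _ t h3 h4 h5
    rw [← R y r t h4]
    rw [← R x s (t + d) h3] at h5
    exact inS_mono S (by omega) (by omega) (by omega) h5
  have z : ∀ x s, n ≤ x + s → qof S.1 x s = 0 := fun x s h => by
    have := hle x s; omega
  refine ⟨z, fun x s => ?_, fun x s => ?_, fun x hx => ?_⟩
  · by_cases h : n ≤ x + s + 1
    · have := z x (s + 1) (by omega)
      have := hle x s
      omega
    have l1 := hle x s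
    have l2 := hle x (s + 1)
    constructor
    · by_contra hc
      have := cmp (x := x) (s := s) (y := x) (r := s + 1) 1 (by omega) (by omega) (by omega)
        (n - x - s - qof S.1 x (s + 1) - 1) (by omega) (by omega) (by omega)
      omega
    · by_contra hc
      have := cmp (x := x) (s := s + 1) (y := x) (r := s) 0 (by omega) (by omega) (by omega)
        (n - x - s - qof S.1 x s) (by omega) (by omega) (by omega)
      omega
  · by_cases h : n ≤ x + s + 1
    · have := z x (s + 1) (by omega)
      have := z (x + 1) s (by omega)
      omega
    have l1 := hle x s
    have l2 := hle x (s + 1)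
    have l3 := hle (x + 1) s
    constructor
    · by_contra hc
      have := cmp (x := x + 1) (s := s) (y := x) (r := s + 1) 0 (by omega) (by omega) (by omega)
        (n - x - s - 1 - qof S.1 x (s + 1)) (by omega) (by omega) (by omega)
      omega
    · by_contra hc
      have := cmp (x := x) (s := s) (y := x + 1) (r := s) 1 (by omega) (by omega) (by omega)
        (n - x - s - 1 - qof S.1 (x + 1) s) (by omega) (by omega) (by omega)
      omega
  · have l1 := hle x 0
    have l2 := hle 0 x
    have key : ∀ t, x + t < n → (x + t + qof S.1 x 0 < n ↔ ¬ (n - 1 - t + qof S.1 0 x < n)) := by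
      intro t ht
      have a := R x 0 t (by omega)
      have b := R 0 x (n - 1 - x - t) (by omega)
      rw [inS_comp S (by omega) (by omega) (by omega)] at a
      rw [show 0 + x + (n - 1 - x - t) = n - 1 - t by omega,
        show 0 + (n - 1 - x - t) = n - 1 - x - t by omega] at b
      rw [show n - 1 - (x + 0 + t) = n - 1 - x - t by omega,
        show n - 1 - (x + t) = n - 1 - x - t by omega, inS_cyc, inS_cyc, b] at a
      rw [← a.symm]
      simp
    by_contra hc
    by_cases h : qof S.1 x 0 + qof S.1 0 x < n - x
    · have := key (qof S.1 0 x) (by omega)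
      omega
    · have := key (n - x - qof S.1 x 0) (by omega)
      omega

/-- uniqueness of the plane partition -/
theorem RR_inj {n : ℕ} (S S' : PP n) (q : ℕ → ℕ → ℕ) (h : RR n S.1 q) (h' : RR n S'.1 q) :
    S = S' := by
  have plus : ∀ i j k, i < n → k ≤ j → j ≤ i → (inS S.1 i j k ↔ inS S'.1 i j k) := by
    intro i j k hi hk hj
    have a := h (j - k) (i - j) k (by omega)
    have b := h' (j - k) (i - j) k (by omega)
    rw [show j - k + (i - j) + k = i by omega, show j - k + k = j by omega] at a b
    rw [a, b]
  have front : ∀ i j k, i < n → j ≤ i → k ≤ i → (inS S.1 i j k ↔ inS S'.1 i j k) := by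
    intro i j k hi hj hk
    by_cases hkj : k ≤ j
    · exact plus i j k hi hkj hj
    · rw [inS_comp S (by omega) (by omega) (by omega), inS_comp S' (by omega) (by omega) (by omega),
        inS_cyc S, inS_cyc S', plus _ _ _ (by omega) (by omega) (by omega)]
  have all : ∀ i j k, i < n → j < n → k < n → (inS S.1 i j k ↔ inS S'.1 i j k) := by
    intro i j k hi hj hk
    by_cases h1 : j ≤ i ∧ k ≤ i
    · exact front i j k hi h1.1 h1.2
    · by_cases h2 : k ≤ j ∧ i ≤ j
      · rw [inS_cyc S, inS_cyc S']; exact front j k i hj h2.1 h2.2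
      · rw [← inS_cyc S, ← inS_cyc S']; exact front k i j hk (by omega) (by omega)
  apply Subtype.ext
  ext ⟨i, j, k⟩
  have := all i j k i.2 j.2 k.2
  constructor
  · intro hS
    exact (this.1 ⟨i.2, j.2, k.2, hS⟩).2.2.2
  · intro hS
    exact (this.2 ⟨i.2, j.2, k.2, hS⟩).2.2.2

section Build
variable (n : ℕ) (q : ℕ → ℕ → ℕ)

def pl (i j k : ℕ) : Prop := k ≤ j ∧ j ≤ i ∧ i + q (j - k) (i - j) < n
def mi (i j k : ℕ) : Prop := k ≤ j ∧ j ≤ i ∧ k < q (i - j) (j - k)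
def mem (i j k : ℕ) : Prop := pl n q i j k ∨ pl n q j k i ∨ pl n q k i j ∨
  mi q i k j ∨ mi q j i k ∨ mi q k j i

variable {n q}

theorem mem_cyc (i j k : ℕ) : mem n q i j k ↔ mem n q j k i := by
  simp only [mem]; tauto

theorem tie1 (hq : QC n q) {a c : ℕ} (ha : a < n) (hc : c ≤ a) : pl n q a a c ↔ mi q a a c := by
  have := hq.2.2.2 (a - c) (by omega)
  simp only [pl, mi, Nat.sub_self]
  omega

theorem tie2 (hq : QC n q) {a c : ℕ} (ha : a < n) (hc : c ≤ a) : pl n q a c c ↔ mi q a c c := by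
  have := hq.2.2.2 (a - c) (by omega)
  simp only [pl, mi, Nat.sub_self]
  omega

theorem mem_plus (hq : QC n q) {i j k : ℕ} (hi : i < n) (hj : j ≤ i) (hk : k ≤ j) :
    mem n q i j k ↔ i + q (j - k) (i - j) < n := by
  have e : pl n q i j k ↔ i + q (j - k) (i - j) < n := by simp only [pl]; omega
  rw [← e]
  constructor
  · rintro (h | h | h | h | h | h)
    · exact h
    · obtain ⟨h1, h2, _⟩ := id h
      obtain rfl : j = k := by omega
      obtain rfl : i = j := by omega
      exact h
    · obtain ⟨h1, h2, _⟩ := id h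
      obtain rfl : i = k := by omega
      obtain rfl : i = j := by omega
      exact h
    · obtain ⟨h1, h2, _⟩ := id h
      obtain rfl : j = k := by omega
      exact (tie2 hq hi hj).2 h
    · obtain ⟨h1, h2, _⟩ := id h
      obtain rfl : i = j := by omega
      exact (tie1 hq hi hk).2 h
    · obtain ⟨h1, h2, _⟩ := id h
      obtain rfl : j = k := by omega
      obtain rfl : i = j := by omega
      exact (tie1 hq hi hk).2 h
  · exact fun h => Or.inl h

theorem mem_minus (hq : QC n q) {i j k : ℕ} (hi : i < n) (hk : k ≤ i) (hj : j ≤ k) :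
    mem n q i j k ↔ j < q (i - k) (k - j) := by
  have e : mi q i k j ↔ j < q (i - k) (k - j) := by simp only [mi]; omega
  rw [← e]
  constructor
  · rintro (h | h | h | h | h | h)
    · obtain ⟨h1, h2, _⟩ := id h
      obtain rfl : j = k := by omega
      exact (tie2 hq hi hk).1 h
    · obtain ⟨h1, h2, _⟩ := id h
      obtain rfl : j = k := by omega
      obtain rfl : i = j := by omega
      exact (tie1 hq hi hk).1 h
    · obtain ⟨h1, h2, _⟩ := id h
      obtain rfl : i = k := by omega
      exact (tie1 hq hi hj).1 h
    · exact h
    · obtain ⟨h1, h2, _⟩ := id h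
      obtain rfl : i = j := by omega
      obtain rfl : i = k := by omega
      exact h
    · obtain ⟨h1, h2, _⟩ := id h
      obtain rfl : i = k := by omega
      obtain rfl : i = j := by omega
      exact h
  · exact fun h => Or.inr (Or.inr (Or.inr (Or.inl h)))

theorem mem_comp (hq : QC n q) {i j k : ℕ} (hi : i < n) (hj : j < n) (hk : k < n) :
    mem n q i j k ↔ ¬ mem n q (n - 1 - i) (n - 1 - j) (n - 1 - k) := by
  have front : ∀ i j k, i < n → j ≤ i → k ≤ i →
      (mem n q i j k ↔ ¬ mem n q (n - 1 - i) (n - 1 - j) (n - 1 - k)) := by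
    intro i j k hi hj hk
    by_cases h : k ≤ j
    · rw [mem_plus hq hi hj h, ← mem_cyc, mem_minus hq (by omega) (by omega) (by omega),
        show n - 1 - k - (n - 1 - j) = j - k by omega, show n - 1 - j - (n - 1 - i) = i - j by omega]
      omega
    · rw [mem_minus hq hi hk (by omega), mem_cyc (n - 1 - i), mem_plus hq (by omega) (by omega) (by omega),
        show n - 1 - k - (n - 1 - i) = i - k by omega, show n - 1 - j - (n - 1 - k) = k - j by omega]
      omega
  by_cases h1 : j ≤ i ∧ k ≤ i
  · exact front i j k hi h1.1 h1.2
  · by_cases h2 : k ≤ j ∧ i ≤ j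
    · rw [mem_cyc i, mem_cyc (n - 1 - i)]; exact front j k i hj h2.1 h2.2
    · rw [← mem_cyc k, ← mem_cyc (n - 1 - k)]; exact front k i j hk (by omega) (by omega)

theorem mem_step (hq : QC n q) {i j k : ℕ} (hi : i + 1 < n) (hj : j < n) (hk : k < n)
    (h : mem n q (i + 1) j k) : mem n q i j k := by
  obtain ⟨-, q1, q2, -⟩ := id hq
  by_cases c1 : j ≤ i
  · by_cases c2 : k ≤ i
    · by_cases c3 : k ≤ j
      · rw [mem_plus hq (by omega) (by omega) (by omega)] at h ⊢
        have := q1 (j - k) (i - j)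
        rw [show i + 1 - j = i - j + 1 by omega] at h
        omega
      · rw [mem_minus hq (by omega) (by omega) (by omega)] at h ⊢
        have := q2 (i - k) (k - j)
        rw [show i + 1 - k = i - k + 1 by omega] at h
        omega
    · rw [← mem_cyc, mem_plus hq (by omega) (by omega) (by omega)] at h ⊢
      have := q2 (i - j) (k - (i + 1))
      rw [show i + 1 - j = i - j + 1 by omega] at h
      rw [show k - i = k - (i + 1) + 1 by omega]
      omega
  · by_cases c2 : k ≤ i
    · rw [mem_cyc, mem_minus hq (by omega) (by omega) (by omega)] at h ⊢
      have := q2 (j - (i + 1)) (i - k)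
      rw [show i + 1 - k = i - k + 1 by omega] at h
      rw [show j - i = j - (i + 1) + 1 by omega]
      omega
    · by_cases c3 : k ≤ j
      · rw [mem_cyc, mem_plus hq (by omega) (by omega) (by omega)] at h ⊢
        have := q2 (k - (i + 1)) (j - k)
        rw [show k - i = k - (i + 1) + 1 by omega]
        omega
      · rw [← mem_cyc, mem_minus hq (by omega) (by omega) (by omega)] at h ⊢
        have := q1 (k - j) (j - (i + 1))
        rw [show j - i = j - (i + 1) + 1 by omega]
        omega

theorem mem_mono1 (hq : QC n q) {i j k : ℕ} (d : ℕ) (hi : i + d < n) (hj : j < n) (hk : k < n)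
    (h : mem n q (i + d) j k) : mem n q i j k := by
  induction d with
  | zero => exact h
  | succ d ih => exact ih (by omega) (mem_step hq (by omega) hj hk h)

theorem mem_mono (hq : QC n q) {i j k i' j' k' : ℕ} (hi : i ≤ i') (hj : j ≤ j') (hk : k ≤ k')
    (hi' : i' < n) (hj' : j' < n) (hk' : k' < n) (h : mem n q i' j' k') : mem n q i j k := by
  obtain ⟨a, rfl⟩ := Nat.exists_eq_add_of_le hi
  obtain ⟨b, rfl⟩ := Nat.exists_eq_add_of_le hj
  obtain ⟨c, rfl⟩ := Nat.exists_eq_add_of_le hk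
  have h1 := mem_mono1 hq a hi' hj' hk' h
  rw [mem_cyc] at h1
  have h2 := mem_mono1 hq b hj' hk' (by omega) h1
  rw [mem_cyc] at h2
  have h3 := mem_mono1 hq c hk' (by omega) (by omega) h2
  rwa [mem_cyc] at h3

theorem exists_PP (hq : QC n q) : ∃ S : PP n, RR n S.1 q := by
  let S : Set (Fin n × Fin n × Fin n) := {p | mem n q p.1 p.2.1 p.2.2}
  have h1 : IsLowerSet S := by
    rintro ⟨i', j', k'⟩ ⟨i, j, k⟩ ⟨hi, hj, hk⟩ h
    exact mem_mono hq hi hj hk i'.2 j'.2 k'.2 h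
  have h2 : ∀ i j k : Fin n, (i, j, k) ∈ S ↔ (j, k, i) ∈ S := fun i j k => mem_cyc _ _ _
  have h3 : ∀ i j k : Fin n, (i, j, k) ∈ S ↔ (i.rev, j.rev, k.rev) ∉ S := fun i j k => by
    have := mem_comp hq i.2 j.2 k.2
    have e : ∀ a : Fin n, (a.rev : ℕ) = n - 1 - a := fun a => by rw [Fin.val_rev]; omega
    simp only [S, Set.mem_ofPred_eq, e]
    exact this
  refine ⟨⟨S, h1, h2, h3⟩, ?_⟩
  intro x s t h
  have e : inS S (x + s + t) (x + t) t ↔ mem n q (x + s + t) (x + t) t :=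
    ⟨fun ⟨_, _, _, h⟩ => h, fun h' => ⟨by omega, by omega, by omega, h'⟩⟩
  show inS S (x + s + t) (x + t) t ↔ _
  rw [e, mem_plus hq h (by omega) (by omega), show x + t - t = x by omega,
    show x + s + t - (x + t) = s by omega]

end Build

theorem QC_le {n : ℕ} {q : ℕ → ℕ → ℕ} (hq : QC n q) (x s : ℕ) : q x s ≤ n - x - s := by
  have : ∀ d s, n - x - s = d → q x s ≤ d := by
    intro d
    induction d with
    | zero => intro s h; rw [hq.1 x s (by omega)]
    | succ d ih =>
      intro s h
      have := ih (s + 1) (by omega)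
      have := (hq.2.1 x s).2
      omega
  exact this _ s rfl

theorem card_PP (n : ℕ) : Nat.card (PP n) = Nat.card {q : ℕ → ℕ → ℕ // QC n q} := by
  refine Nat.card_eq_of_bijective (fun S => (⟨qof S.1, qof_QC S⟩ : {q : ℕ → ℕ → ℕ // QC n q})) ⟨?_, ?_⟩
  · intro S S' h
    have h' : qof S.1 = qof S'.1 := congrArg Subtype.val h
    exact RR_inj S S' (qof S.1) (qof_RR S) (h' ▸ qof_RR S')
  · rintro ⟨q, hq⟩
    obtain ⟨S, hS⟩ := exists_PP hq
    exact ⟨S, Subtype.ext (RR_unique S.1 q hS (QC_le hq)).symm⟩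

end PlanePart

section Final

/-- coherent families of particle configurations -/
def KC (n : ℕ) (c : ℕ → Finset ℕ) : Prop :=
  c 0 ⊆ range n ∧ (∀ x, nxt (c x) (c (x + 1))) ∧ ∀ x, (c x).card = cge (range n \ c 0) x

theorem cge_succ (C : Finset ℕ) (s : ℕ) : cge C s = cge C (s + 1) + if s ∈ C then 1 else 0 := by
  rw [cge, cge]
  by_cases h : s ∈ C
  · rw [if_pos h, ← card_insert_of_notMem (s := C.filter (fun c => s + 1 ≤ c)) (a := s) (by simp)]
    congr 1
    ext a
    simp only [mem_filter, mem_insert]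
    constructor
    · rintro ⟨h1, h2⟩
      by_cases h3 : a = s
      · exact Or.inl h3
      · exact Or.inr ⟨h1, by omega⟩
    · rintro (rfl | ⟨h1, h2⟩)
      · exact ⟨h, le_rfl⟩
      · exact ⟨h1, by omega⟩
  · rw [if_neg h, add_zero]
    congr 1
    ext a
    simp only [mem_filter]
    constructor
    · rintro ⟨h1, h2⟩
      have : a ≠ s := fun e => h (e ▸ h1)
      exact ⟨h1, by omega⟩
    · rintro ⟨h1, h2⟩
      exact ⟨h1, by omega⟩

theorem cge_eq_zero {C : Finset ℕ} {n s : ℕ} (h : C ⊆ range n) (hs : n ≤ s) : cge C s = 0 := by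
  rw [cge, card_eq_zero, filter_eq_empty_iff]
  intro a ha
  have := mem_range.1 (h ha)
  omega

theorem cge_sdiff {C : Finset ℕ} {n : ℕ} (h : C ⊆ range n) (s : ℕ) :
    cge (range n \ C) s + cge C s = n - s := by
  rw [cge, cge, ← card_union_of_disjoint (disjoint_filter_filter sdiff_disjoint), ← filter_union,
    sdiff_union_of_subset h]
  have : (range n).filter (fun c => s ≤ c) = Ico s n := by
    ext a; simp; omega
  rw [this, Nat.card_Ico]

/-- configuration of jumps -/
def cof (n : ℕ) (q : ℕ → ℕ → ℕ) (x : ℕ) : Finset ℕ :=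
  (range n).filter (fun y => q x y = q x (y + 1) + 1)

theorem cge_cof {n : ℕ} {q : ℕ → ℕ → ℕ} (hq : QC n q) (x s : ℕ) : cge (cof n q x) s = q x s := by
  have : ∀ d s, n - s = d → cge (cof n q x) s = q x s := by
    intro d
    induction d with
    | zero =>
      intro s h
      rw [hq.1 x s (by omega), cge_eq_zero (C := cof n q x) (n := n) (filter_subset _ _) (by omega)]
    | succ d ih =>
      intro s h
      rw [cge_succ, ih (s + 1) (by omega)]
      have := hq.2.1 x s
      by_cases h' : s ∈ cof n q x
      · rw [if_pos h']
        rw [cof, mem_filter] at h'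
        omega
      · rw [if_neg h']
        rw [cof, mem_filter, mem_range] at h'
        omega
  exact this _ s rfl

theorem KC_zero {n : ℕ} {c : ℕ → Finset ℕ} (hc : KC n c) (x s : ℕ) (h : n ≤ x + s) :
    cge (c x) s = 0 := by
  have : ∀ s x, cge (c x) s ≤ cge (c (x + s)) 0 := by
    intro s
    induction s with
    | zero => intro x; exact le_rfl
    | succ s ih =>
      intro x
      refine ((hc.2.1 x s).1).trans ?_
      have := ih (x + 1)
      rwa [show x + 1 + s = x + (s + 1) by ring] at this
  have h1 := this s x
  rw [cge_zero, hc.2.2, cge_eq_zero (n := n) sdiff_subset h] at h1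
  omega

theorem KC_QC {n : ℕ} {c : ℕ → Finset ℕ} (hc : KC n c) : QC n (fun x s => cge (c x) s) := by
  refine ⟨KC_zero hc, fun x s => ?_, fun x s => hc.2.1 x s, fun x hx => ?_⟩
  · have := cge_succ (c x) s
    dsimp only
    split_ifs at this <;> omega
  · dsimp only
    rw [cge_zero, hc.2.2]
    exact cge_sdiff hc.1 x

theorem QC_KC {n : ℕ} {q : ℕ → ℕ → ℕ} (hq : QC n q) : KC n (cof n q) := by
  refine ⟨filter_subset _ _, fun x s => ?_, fun x => ?_⟩
  · rw [cge_cof hq, cge_cof hq, cge_cof hq]; exact hq.2.2.1 x s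
  · have h := cge_sdiff (C := cof n q 0) (n := n) (filter_subset _ _) x
    rw [cge_cof hq] at h
    rw [← cge_zero, cge_cof hq]
    by_cases hx : x ≤ n
    · have := hq.2.2.2 x hx
      omega
    · rw [hq.1 x 0 (by omega)]
      omega

def qkEquiv (n : ℕ) : {q : ℕ → ℕ → ℕ // QC n q} ≃ {c : ℕ → Finset ℕ // KC n c} where
  toFun q := ⟨cof n q.1, QC_KC q.2⟩
  invFun c := ⟨fun x s => cge (c.1 x) s, KC_QC c.2⟩
  left_inv q := by
    apply Subtype.ext
    funext x s
    exact cge_cof q.2 x s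
  right_inv c := by
    apply Subtype.ext
    funext x
    ext y
    show y ∈ (range n).filter (fun y => cge (c.1 x) y = cge (c.1 x) (y + 1) + 1) ↔ _
    have h := cge_succ (c.1 x) y
    rw [mem_filter, mem_range]
    constructor
    · rintro ⟨_, h2⟩
      by_contra h3
      rw [if_neg h3] at h
      omega
    · intro h3
      rw [if_pos h3] at h
      refine ⟨?_, h⟩
      by_contra h4
      have := KC_zero c.2 x y (by omega)
      omega

def kcEquiv (m : ℕ) : {c : ℕ → Finset ℕ // KC (m + m) c} ≃
    Σ C : {C // C ∈ powersetCard m (range (m + m))}, Chain C.1 (range (m + m) \ C.1) where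
  toFun c := ⟨⟨c.1 0, mem_powersetCard.2 ⟨c.2.1, by
      have h1 := c.2.2.2 0
      have h2 := cge_sdiff c.2.1 0
      rw [cge_zero (c.1 0)] at h2
      omega⟩⟩, ⟨c.1, rfl, c.2.2.1, c.2.2.2⟩⟩
  invFun p := ⟨p.2.1, by
    have h0 := p.2.2.1
    refine ⟨?_, p.2.2.2.1, ?_⟩
    · rw [h0]; exact (mem_powersetCard.1 p.1.2).1
    · rw [h0]; exact p.2.2.2.2⟩
  left_inv c := rfl
  right_inv p := by
    obtain ⟨⟨C', hC'⟩, ⟨c, hc, h1, h2⟩⟩ := p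
    change c 0 = C' at hc
    subst hc
    rfl

theorem main (m : ℕ) : (Nat.card (PP (m + m)) : ℚ) =
      ∏ i ∈ range m, (Nat.factorial (3 * i + 1) : ℚ) ^ 2 / (Nat.factorial (i + m) : ℚ) ^ 2 := by
  have fin : ∀ C : {C // C ∈ powersetCard m (range (m + m))},
      Finite (Chain C.1 (range (m + m) \ C.1)) := fun C => (chain_card (m + m) _ _ sdiff_subset).1
  obtain ⟨s, hs, hd⟩ := dd_factor m
  have h1 : (Nat.card (PP (m + m)) : ℚ) = s *
      ∏ i ∈ range m, (Nat.factorial (3 * i + 1) : ℚ) ^ 2 / (Nat.factorial (i + m) : ℚ) ^ 2 := by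
    rw [card_PP, Nat.card_congr ((qkEquiv _).trans (kcEquiv m)), Nat.card_sigma, Nat.cast_sum,
      ← gram_det, cauchy_binet, mul_sum, ← sum_coe_sort (powersetCard m (range (m + m)))]
    refine sum_congr rfl fun C _ => ?_
    rw [(chain_card (m + m) _ _ sdiff_subset).2, hd C.1 C.2]
  have hpos : (0 : ℚ) < ∏ i ∈ range m,
      (Nat.factorial (3 * i + 1) : ℚ) ^ 2 / (Nat.factorial (i + m) : ℚ) ^ 2 :=
    prod_pos fun i _ => by positivity
  rcases hs with rfl | rfl
  · rw [h1, one_mul]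
  · have : (0 : ℚ) ≤ Nat.card (PP (m + m)) := Nat.cast_nonneg _
    rw [h1] at this
    linarith

end Final

end CSSC

/-- (Kuperberg) For every `m ≥ 0`, the number of cyclically symmetric self-complementary plane
partitions in the `2m`-cube (lower sets `S` of `Fin (2m) × Fin (2m) × Fin (2m)` with
`(i,j,k) ∈ S ↔ (j,k,i) ∈ S` and `(i,j,k) ∈ S ↔ (2m-1-i, 2m-1-j, 2m-1-k) ∉ S`, where
`Fin.rev i = 2m-1-i`) equals `∏_{i=0}^{m-1} ((3i+1)!)²/((i+m)!)²`. -/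
theorem card_cyclicallySymmetric_selfComplementary_planePartitions (m : ℕ) :
    (Nat.card {S : Set (Fin (2 * m) × Fin (2 * m) × Fin (2 * m)) // IsLowerSet S ∧
        (∀ i j k : Fin (2 * m), (i, j, k) ∈ S ↔ (j, k, i) ∈ S) ∧
        (∀ i j k : Fin (2 * m), (i, j, k) ∈ S ↔ (i.rev, j.rev, k.rev) ∉ S)} : ℚ) =
      ∏ i ∈ Finset.range m,
        (Nat.factorial (3 * i + 1) : ℚ) ^ 2 / (Nat.factorial (i + m) : ℚ) ^ 2 := by
  rw [two_mul]
  exact CSSC.main m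
end
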